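/- Let A = kQ/I be a (locally) gentle algebra. The prime (two-sided) ideals of A are exactly: (1) the ideal m_v for each v ∈ Q0; (2) the ideal ann_A(J_γ) for each infinite maximal path γ of A; (3) the ideal p(γ,p) = ann_A(J_γ) + ⟨p(m_γ)⟩ for each infinite maximal path γ and each irreducible polynomial p(t) ∈ k[t] with deg(p) ≥ 1 and p(0) ≠ 0. In particular, A is a prime ring (the zero ideal is prime) if and only if A has exactly one maximal path and that path is infinite; the height-zero primes are the ideals ann_A(J_γ) for γ an infinite maximal path together with the m_v for vertices v through which no infinite maximal path passes; and if γ is an infinite maximal path passing through v and p ≠ t is irreducible monic, then ann_A(J_γ) ⊆ m_v and ann_A(J_γ) ⊆ p(γ,p). -/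

import Mathlib

/- Common framework for (locally) gentle algebras -/

noncomputable section
open scoped BigOperators
open CategoryTheory

namespace LocGentle

/-- A finite connected quiver with at least one vertex and one arrow. -/
structure Quiv where
  V : Type
  Arr : Type
  [fintypeV : Fintype V]
  [fintypeA : Fintype Arr]
  [decEqV : DecidableEq V]
  [decEqA : DecidableEq Arr]
  src : Arr → V
  tgt : Arr → V
  [nonemptyV : Nonempty V]
  [nonemptyA : Nonempty Arr]
  connected : (SimpleGraph.fromRel (fun v w => ∃ a, src a = v ∧ tgt a = w)).Connected

attribute [instance] Quiv.fintypeV Quiv.fintypeA Quiv.decEqV Quiv.decEqA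
  Quiv.nonemptyV Quiv.nonemptyA

variable (Q : Quiv)

/-- in-degree of a vertex -/
def indeg (v : Q.V) : ℕ := (Finset.univ.filter (fun a => Q.tgt a = v)).card

/-- out-degree of a vertex -/
def outdeg (v : Q.V) : ℕ := (Finset.univ.filter (fun a => Q.src a = v)).card

/-- a list of arrows is composable (forms a path) -/
def Composable (l : List Q.Arr) : Prop := l.Chain' (fun a b => Q.tgt a = Q.src b)

variable {Q}

/-- source vertex of a nonempty word -/
def wSrc? (l : List Q.Arr) : Option Q.V := l.head?.map Q.src

/-- target vertex of a nonempty word -/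
def wTgt? (l : List Q.Arr) : Option Q.V := l.getLast?.map Q.tgt

/-- target of a word, with a default value (used for stationary paths) -/
def wTgtD (l : List Q.Arr) (v : Q.V) : Q.V := (l.getLast?.map Q.tgt).getD v

/-- last arrow of a word, with a (junk) default -/
def wLast (l : List Q.Arr) : Q.Arr := l.getLast?.getD (Classical.arbitrary _)

variable (rel : Q.Arr → Q.Arr → Prop)

/-- A word is allowed (is a basis path of `A = kQ/I`) if consecutive arrows are
composable and no consecutive pair lies in the relation set generating `I`. -/
def AllowedWord (l : List Q.Arr) : Prop :=
  l.Chain' (fun a b => Q.tgt a = Q.src b ∧ ¬ rel a b)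

/-- right maximal paths (of positive length) -/
def RightMaxWord (l : List Q.Arr) : Prop :=
  l ≠ [] ∧ AllowedWord rel l ∧ ∀ a : Q.Arr, ¬ AllowedWord rel (l ++ [a])

/-- left maximal paths (of positive length) -/
def LeftMaxWord (l : List Q.Arr) : Prop :=
  l ≠ [] ∧ AllowedWord rel l ∧ ∀ a : Q.Arr, ¬ AllowedWord rel (a :: l)

/-- finite maximal paths -/
def FiniteMaxWord (l : List Q.Arr) : Prop := RightMaxWord rel l ∧ LeftMaxWord rel l

/-- a word is primitive if it is not a proper power -/
def PrimitiveWord (l : List Q.Arr) : Prop :=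
  ∀ (l' : List Q.Arr) (n : ℕ), 2 ≤ n → l ≠ (List.replicate n l').flatten

/-- a primitive cycle `c` with `c² ∉ I`; these represent the infinite maximal paths `c^∞`. -/
def PrimCycleSq (c : List Q.Arr) : Prop :=
  c ≠ [] ∧ AllowedWord rel (c ++ c) ∧ wTgt? c = wSrc? c ∧ PrimitiveWord c

/-- the maximal path `γ_α` containing `α` is infinite -/
def InfThrough (a : Q.Arr) : Prop := ∃ c, PrimCycleSq rel c ∧ a ∈ c

/-- the maximal path `γ_α` containing `α` is finite -/
def FinThrough (a : Q.Arr) : Prop := ∃ l, FiniteMaxWord rel l ∧ a ∈ l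

/-- the rotation of the cycle `c` starting at the arrow `a`; when `a ∈ c` and `c` has no
duplicates this is the primitive cycle `γ_r(a)`. -/
def rotTo (c : List Q.Arr) (a : Q.Arr) : List Q.Arr :=
  c.dropWhile (fun b => b != a) ++ c.takeWhile (fun b => b != a)

/-- the relation set of the Koszul dual `A#`; its allowed words are the forbidden paths of `A`. -/
def dualRel : Q.Arr → Q.Arr → Prop := fun a b => Q.tgt a = Q.src b ∧ ¬ rel a b

/-- a forbidden path of `A`, i.e. a path of the Koszul dual `A#` -/
def ForbiddenWord (l : List Q.Arr) : Prop := AllowedWord (dualRel rel) l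

variable (Q)

/-- The defining conditions (i)-(iv) of a (locally) gentle algebra, in terms of the set of
length-two relations generating the ideal `I`: an algebra satisfying them is gentle if it
is finite dimensional and locally gentle otherwise. -/
structure IsGentleRel : Prop where
  indeg_le : ∀ v : Q.V, indeg Q v ≤ 2
  outdeg_le : ∀ v : Q.V, outdeg Q v ≤ 2
  rel_comp : ∀ a b : Q.Arr, rel a b → Q.tgt a = Q.src b
  cond_ii : ∀ a b b' : Q.Arr, b ≠ b' → Q.tgt b = Q.src a → Q.tgt b' = Q.src a →
    Xor' (rel b a) (rel b' a)
  cond_iii : ∀ a b b' : Q.Arr, b ≠ b' → Q.tgt a = Q.src b → Q.tgt a = Q.src b' →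
    Xor' (rel a b) (rel a b')

/-- `Q` is (as a quiver) the extended Dynkin quiver `Ã_n` (for `n = |Q₀| - 1`):
every vertex has in-degree and out-degree one. -/
def IsAtilde : Prop := ∀ v : Q.V, indeg Q v = 1 ∧ outdeg Q v = 1

/-- paths of `Q`, including the stationary paths (`w = []`) at each vertex -/
structure Pth where
  s : Q.V
  w : List Q.Arr
  hs : ∀ a ∈ w.head?, Q.src a = s
  hc : Composable Q w

variable {Q}

/-- target of a path -/
def Pth.t (p : Pth Q) : Q.V := wTgtD p.w p.s

/-- length of a path -/
def Pth.len (p : Pth Q) : ℕ := p.w.length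

/-- a basis path of `A = kQ/I` -/
def Pth.Allowed (p : Pth Q) : Prop := AllowedWord rel p.w

end LocGentle
namespace LocGentle

variable (k : Type) [Field k] (Q : Quiv) (rel : Q.Arr → Q.Arr → Prop)

/-- The defining relations presenting `A = kQ/I` as a quotient of the free algebra on
the stationary paths (vertices) and arrows: the path algebra relations together with
the relations `αβ = 0` for the length-two paths `αβ` generating `I`. -/
inductive GARel : FreeAlgebra k (Q.V ⊕ Q.Arr) → FreeAlgebra k (Q.V ⊕ Q.Arr) → Prop
  | idem (v : Q.V) : GARel (FreeAlgebra.ι k (Sum.inl v) * FreeAlgebra.ι k (Sum.inl v))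
      (FreeAlgebra.ι k (Sum.inl v))
  | orth (v w : Q.V) : v ≠ w → GARel (FreeAlgebra.ι k (Sum.inl v) * FreeAlgebra.ι k (Sum.inl w)) 0
  | unit : GARel (∑ v : Q.V, FreeAlgebra.ι k (Sum.inl v)) 1
  | src_mul (a : Q.Arr) : GARel (FreeAlgebra.ι k (Sum.inl (Q.src a)) * FreeAlgebra.ι k (Sum.inr a))
      (FreeAlgebra.ι k (Sum.inr a))
  | mul_tgt (a : Q.Arr) : GARel (FreeAlgebra.ι k (Sum.inr a) * FreeAlgebra.ι k (Sum.inl (Q.tgt a)))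
      (FreeAlgebra.ι k (Sum.inr a))
  | src_zero (v : Q.V) (a : Q.Arr) : v ≠ Q.src a →
      GARel (FreeAlgebra.ι k (Sum.inl v) * FreeAlgebra.ι k (Sum.inr a)) 0
  | tgt_zero (v : Q.V) (a : Q.Arr) : v ≠ Q.tgt a →
      GARel (FreeAlgebra.ι k (Sum.inr a) * FreeAlgebra.ι k (Sum.inl v)) 0
  | rel_zero (a b : Q.Arr) : rel a b →
      GARel (FreeAlgebra.ι k (Sum.inr a) * FreeAlgebra.ι k (Sum.inr b)) 0

/-- The (locally) gentle algebra `A = kQ/I`. -/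
abbrev GA := RingQuot (GARel k Q rel)

/-- the image in `A` of the stationary path at `v` -/
def vtx (v : Q.V) : GA k Q rel := RingQuot.mkAlgHom k _ (FreeAlgebra.ι k (Sum.inl v))

/-- the image in `A` of the arrow `a` -/
def arr (a : Q.Arr) : GA k Q rel := RingQuot.mkAlgHom k _ (FreeAlgebra.ι k (Sum.inr a))

/-- the image in `A` of the word `l` (the product of its arrows) -/
def wordEl (l : List Q.Arr) : GA k Q rel := (l.map (arr k Q rel)).prod

variable {Q}

/-- the image in `A` of a path (a stationary path maps to the corresponding idempotent) -/
def Pth.el (p : Pth Q) : GA k Q rel := vtx k Q rel p.s * wordEl k Q rel p.w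

variable (Q)

/-- the `n`-th graded component `A_n` of `A`, spanned by the images of paths of length `n` -/
def deg (n : ℕ) : Submodule k (GA k Q rel) :=
  Submodule.span k {x | ∃ p : Pth Q, p.Allowed rel ∧ p.len = n ∧ x = p.el k rel}

/-- the augmentation ideal `A₊` (as a `k`-submodule), spanned by paths of positive length -/
def degPlus : Submodule k (GA k Q rel) :=
  Submodule.span k {x | ∃ p : Pth Q, p.Allowed rel ∧ 1 ≤ p.len ∧ x = p.el k rel}

/-- the Hilbert series of `A` (with integer coefficients) -/
def hilb : PowerSeries ℤ :=
  PowerSeries.mk fun n => (Module.finrank k (deg k Q rel n) : ℤ)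

/-- the Hilbert series of `A` (with rational coefficients) -/
def hilbQ : PowerSeries ℚ :=
  PowerSeries.mk fun n => (Module.finrank k (deg k Q rel n) : ℚ)

/-- the number `k_n` of finite maximal paths of length at least `n` -/
def numFMP (n : ℕ) : ℕ := {l : List Q.Arr | FiniteMaxWord rel l ∧ n ≤ l.length}.ncard

/-- the Gelfand-Kirillov dimension of `A`:
`limsup_n log (dim_k A_{≤ n}) / log n`. -/
def GKdim : ℝ :=
  Filter.limsup (fun n : ℕ =>
      Real.log (Module.finrank k ↥(⨆ i ∈ Finset.range (n + 1), deg k Q rel i)) / Real.log n)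
    Filter.atTop

/-- the central element `m_γ` attached to the infinite maximal path `γ = c^∞`:
the sum over the arrows `α` of `c` of the primitive cycle `γ_r(α)` starting at `α`. -/
def mEl (c : List Q.Arr) : GA k Q rel := (c.map fun a => wordEl k Q rel (rotTo c a)).sum

/-- evaluation of a polynomial at `x ∈ A`; `polyEval k Q rel p x` is `p(x)`. -/
def polyEval (p : Polynomial k) (x : GA k Q rel) : GA k Q rel :=
  Polynomial.eval₂ (algebraMap k (GA k Q rel)) x p

end LocGentle
namespace LocGentle

variable (k : Type) [Field k] (Q : Quiv) (rel : Q.Arr → Q.Arr → Prop)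

/-! ### Two-sided ideals and primes -/

/-- a prime (two-sided) ideal -/
def IsPrimeTI (P : TwoSidedIdeal (GA k Q rel)) : Prop :=
  P ≠ ⊤ ∧ ∀ x y : GA k Q rel, (∀ a : GA k Q rel, x * a * y ∈ P) → x ∈ P ∨ y ∈ P

/-- the maximal ideal `𝔪_v` of `A` which does not contain `ε_v`: it is generated by the
stationary paths at the other vertices together with all loops at `v`. -/
def mIdeal (v : Q.V) : TwoSidedIdeal (GA k Q rel) :=
  TwoSidedIdeal.span
    ({x | ∃ w : Q.V, w ≠ v ∧ x = vtx k Q rel w} ∪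
     {x | ∃ a : Q.Arr, Q.src a = v ∧ Q.tgt a = v ∧ x = arr k Q rel a})

/-- the ideal `J_γ` corresponding to the infinite maximal path `γ = c^∞`, generated by
all arrows lying on `γ` -/
def Jgamma (c : List Q.Arr) : TwoSidedIdeal (GA k Q rel) :=
  TwoSidedIdeal.span {x | ∃ a ∈ c, x = arr k Q rel a}

/-- the left annihilator of `J_γ` -/
def annJ (c : List Q.Arr) : Set (GA k Q rel) :=
  {x | ∀ y ∈ Jgamma k Q rel c, x * y = 0}

/-! ### The simple modules `S(v)`, and `Ext` groups -/

/-- the algebra map `A → k` corresponding to the vertex `v` (projection onto the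
coefficient of `ε_v`) -/
def vtxHomAux (v : Q.V) : FreeAlgebra k (Q.V ⊕ Q.Arr) →ₐ[k] k :=
  FreeAlgebra.lift k (Sum.elim (fun w => if w = v then (1 : k) else 0) (fun _ => 0))

theorem vtxHomAux_rel (v : Q.V) : ∀ ⦃x y⦄, GARel k Q rel x y →
    vtxHomAux k Q v x = vtxHomAux k Q v y := by
  intro x y h
  cases h with
  | idem w =>
      simp only [vtxHomAux, map_mul, FreeAlgebra.lift_ι_apply, Sum.elim_inl]
      split_ifs <;> simp
  | orth w w' hne =>
      simp only [vtxHomAux, map_mul, FreeAlgebra.lift_ι_apply, Sum.elim_inl, map_zero]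
      split_ifs with h1 h2 <;> first | (exact absurd (h1.trans h2.symm) hne) | simp
  | unit =>
      simp only [vtxHomAux, map_sum, FreeAlgebra.lift_ι_apply, Sum.elim_inl, map_one]
      simp [Finset.sum_ite_eq' Finset.univ v (fun _ => (1:k))]
  | src_mul a =>
      simp [vtxHomAux, map_mul, FreeAlgebra.lift_ι_apply]
  | mul_tgt a =>
      simp [vtxHomAux, map_mul, FreeAlgebra.lift_ι_apply]
  | src_zero w a hw =>
      simp [vtxHomAux, map_mul, FreeAlgebra.lift_ι_apply]
  | tgt_zero w a hw =>
      simp [vtxHomAux, map_mul, FreeAlgebra.lift_ι_apply]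
  | rel_zero a b hab =>
      simp [vtxHomAux, map_mul, FreeAlgebra.lift_ι_apply]

/-- the ring map `A → k` corresponding to the vertex `v` -/
def vtxHom (v : Q.V) : GA k Q rel →+* k :=
  RingQuot.lift ⟨(vtxHomAux k Q v).toRingHom, fun _ _ h => vtxHomAux_rel k Q rel v h⟩

/-- the ring map `A → k^{Q₀}` with kernel `A₊` -/
def SHom : GA k Q rel →+* (Q.V → k) := Pi.ringHom fun v => vtxHom k Q rel v

/-- the graded simple right `A`-module `S(v)` at the vertex `v` -/
def SvModR (v : Q.V) : ModuleCat (GA k Q rel)ᵐᵒᵖ :=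
  @ModuleCat.of _ _ k _
    (Module.compHom k ((vtxHom k Q rel v).fromOpposite (fun _ _ => mul_comm _ _)))

/-- the graded simple left `A`-module `S(v)` at the vertex `v` -/
def SvModL (v : Q.V) : ModuleCat (GA k Q rel) :=
  @ModuleCat.of _ _ k _ (Module.compHom k (vtxHom k Q rel v))

/-- `S = A/A₊ ≅ ⊕_v S(v)` as a right `A`-module -/
def SModR : ModuleCat (GA k Q rel)ᵐᵒᵖ :=
  @ModuleCat.of _ _ (Q.V → k) _
    (Module.compHom _ ((SHom k Q rel).fromOpposite (fun _ _ => mul_comm _ _)))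

/-- `S = A/A₊` as a left `A`-module -/
def SModL : ModuleCat (GA k Q rel) :=
  @ModuleCat.of _ _ (Q.V → k) _ (Module.compHom _ (SHom k Q rel))

/-- `A` as a right module over itself -/
def AModR : ModuleCat (GA k Q rel)ᵐᵒᵖ := ModuleCat.of _ (GA k Q rel)

/-- `A` as a left module over itself -/
def AModL : ModuleCat (GA k Q rel) := ModuleCat.of _ (GA k Q rel)

/-- nonvanishing of `Ext^i(M, N)` for modules over a ring `R` -/
def extNZ {R : Type} [Ring R] (i : ℕ) (M N : ModuleCat R) : Prop :=
  ¬ Subsingleton (((Ext ℤ (ModuleCat R) i).obj (Opposite.op M)).obj N)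

/-- nonvanishing of `Ext^i_A(S(v), A)` in right `A`-modules.  (For the Noetherian graded
algebra `A` with the finitely generated modules `S(v)` and `A` this agrees with the graded
`Ext`-group, summed over all shifts, used in the paper.) -/
def extSvNZ (i : ℕ) (v : Q.V) : Prop := extNZ i (SvModR k Q rel v) (AModR k Q rel)

/-- nonvanishing of `Ext^i_A(S, A)` in right `A`-modules -/
def extSNZ (i : ℕ) : Prop := extNZ i (SModR k Q rel) (AModR k Q rel)

/-- the depth of `A`: `min { i : Ext^i_A(S, A) ≠ 0 }` -/
def depth : ℕ∞ := sInf {n : ℕ∞ | ∃ i : ℕ, n = i ∧ extSNZ k Q rel i}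

/-- the right self-injective dimension of `A`:
`sup { i : Ext^i(M, A) ≠ 0 for some right module M }` -/
def rInjDim : ℕ∞ :=
  sSup {n : ℕ∞ | ∃ (i : ℕ) (M : ModuleCat.{0} (GA k Q rel)ᵐᵒᵖ), n = i ∧ extNZ i M (AModR k Q rel)}

/-- the left self-injective dimension of `A` -/
def lInjDim : ℕ∞ :=
  sSup {n : ℕ∞ | ∃ (i : ℕ) (M : ModuleCat.{0} (GA k Q rel)), n = i ∧ extNZ i M (AModL k Q rel)}

/-- the right global dimension of `A`: `sup { i : Ext^i(M, N) ≠ 0 }` over right modules -/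
def rGlDim : ℕ∞ :=
  sSup {n : ℕ∞ | ∃ (i : ℕ) (M N : ModuleCat.{0} (GA k Q rel)ᵐᵒᵖ), n = i ∧ extNZ i M N}

/-- the left global dimension of `A` -/
def lGlDim : ℕ∞ :=
  sSup {n : ℕ∞ | ∃ (i : ℕ) (M N : ModuleCat.{0} (GA k Q rel)), n = i ∧ extNZ i M N}

end LocGentle
namespace LocGentle

section General

variable {k : Type} [Field k] {Q : Quiv} {rel : Q.Arr → Q.Arr → Prop}

theorem vtx_mul_self (v : Q.V) : vtx k Q rel v * vtx k Q rel v = vtx k Q rel v := by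
  simpa [vtx, arr] using RingQuot.mkAlgHom_rel k (GARel.idem (k := k) (rel := rel) v)

theorem vtx_mul_vtx_of_ne {v w : Q.V} (h : v ≠ w) : vtx k Q rel v * vtx k Q rel w = 0 := by
  simpa [vtx, arr] using RingQuot.mkAlgHom_rel k (GARel.orth (k := k) (rel := rel) v w h)

theorem sum_vtx : ∑ v : Q.V, vtx k Q rel v = 1 := by
  simpa [vtx, arr] using RingQuot.mkAlgHom_rel k (GARel.unit (k := k) (Q := Q) (rel := rel))

theorem vtx_mul_arr (v : Q.V) (a : Q.Arr) :
    vtx k Q rel v * arr k Q rel a = if v = Q.src a then arr k Q rel a else 0 := by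
  split_ifs with h
  · subst h
    simpa [vtx, arr] using RingQuot.mkAlgHom_rel k (GARel.src_mul (k := k) (rel := rel) a)
  · simpa [vtx, arr] using RingQuot.mkAlgHom_rel k (GARel.src_zero (k := k) (rel := rel) v a h)

theorem arr_mul_vtx (v : Q.V) (a : Q.Arr) :
    arr k Q rel a * vtx k Q rel v = if v = Q.tgt a then arr k Q rel a else 0 := by
  split_ifs with h
  · subst h
    simpa [vtx, arr] using RingQuot.mkAlgHom_rel k (GARel.mul_tgt (k := k) (rel := rel) a)
  · simpa [vtx, arr] using RingQuot.mkAlgHom_rel k (GARel.tgt_zero (k := k) (rel := rel) v a h)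

theorem arr_mul_arr_of_rel {a b : Q.Arr} (h : rel a b) : arr k Q rel a * arr k Q rel b = 0 := by
  simpa [vtx, arr] using RingQuot.mkAlgHom_rel k (GARel.rel_zero (k := k) (rel := rel) a b h)

theorem arr_mul_arr_of_tgt_ne {a b : Q.Arr} (h : Q.tgt a ≠ Q.src b) :
    arr k Q rel a * arr k Q rel b = 0 := by
  have h1 := arr_mul_vtx (k := k) (rel := rel) (Q.tgt a) a
  rw [if_pos rfl] at h1
  rw [← h1, mul_assoc, vtx_mul_arr, if_neg h, mul_zero]

theorem allowed_of_arr_mul_arr_ne_zero {a b : Q.Arr} (h : arr k Q rel a * arr k Q rel b ≠ 0) :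
    Q.tgt a = Q.src b ∧ ¬ rel a b :=
  ⟨by_contra fun h' => h (arr_mul_arr_of_tgt_ne h'), fun h' => h (arr_mul_arr_of_rel h')⟩

/-- Induction principle: `A` is generated by the stationary paths and the arrows. -/
theorem GA.induction {C : GA k Q rel → Prop}
    (scalar : ∀ r : k, C (algebraMap k _ r)) (vertex : ∀ v, C (vtx k Q rel v))
    (arrow : ∀ a, C (arr k Q rel a)) (mul : ∀ x y, C x → C y → C (x * y))
    (add : ∀ x y, C x → C y → C (x + y)) (x : GA k Q rel) : C x := by
  obtain ⟨y, rfl⟩ := RingQuot.mkAlgHom_surjective k (GARel k Q rel) x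
  induction y using FreeAlgebra.induction with
  | grade0 r => simpa using scalar r
  | grade1 z =>
      cases z with
      | inl v => exact vertex v
      | inr a => exact arrow a
  | mul a b ha hb => rw [map_mul]; exact mul _ _ ha hb
  | add a b ha hb => rw [map_add]; exact add _ _ ha hb

/-- A subspace stable under left multiplication by the generators is a left ideal. -/
theorem mul_mem_of_generators {W : Submodule k (GA k Q rel)}
    (vertex : ∀ v, ∀ y ∈ W, vtx k Q rel v * y ∈ W)
    (arrow : ∀ a, ∀ y ∈ W, arr k Q rel a * y ∈ W) (x : GA k Q rel) :
    ∀ y ∈ W, x * y ∈ W := by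
  induction x using GA.induction with
  | scalar r => intro y hy; rw [← Algebra.smul_def]; exact W.smul_mem _ hy
  | vertex v => exact vertex v
  | arrow a => exact arrow a
  | mul x y hx hy => intro z hz; rw [mul_assoc]; exact hx _ (hy _ hz)
  | add x y hx hy => intro z hz; rw [add_mul]; exact W.add_mem (hx _ hz) (hy _ hz)

section Lift

variable {B : Type*} [Semiring B] [Algebra k B] {e : Q.V → B} {x : Q.Arr → B}

variable (k rel e x) in
/-- Elements `e v` and `x a` of a `k`-algebra satisfying the defining relations of `A`. -/
structure GARep : Prop where
  idem : ∀ v, e v * e v = e v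
  orth : ∀ v w, v ≠ w → e v * e w = 0
  unit : ∑ v, e v = 1
  src_mul : ∀ a, e (Q.src a) * x a = x a
  mul_tgt : ∀ a, x a * e (Q.tgt a) = x a
  src_zero : ∀ v a, v ≠ Q.src a → e v * x a = 0
  tgt_zero : ∀ v a, v ≠ Q.tgt a → x a * e v = 0
  rel_zero : ∀ a b, rel a b → x a * x b = 0

theorem GARep.compat (h : GARep rel e x) ⦃y z : FreeAlgebra k (Q.V ⊕ Q.Arr)⦄
    (hyz : GARel k Q rel y z) :
    FreeAlgebra.lift k (Sum.elim e x) y = FreeAlgebra.lift k (Sum.elim e x) z := by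
  cases hyz with
  | idem v => simpa using h.idem v
  | orth v w hvw => simpa using h.orth v w hvw
  | unit => simpa using h.unit
  | src_mul a => simpa using h.src_mul a
  | mul_tgt a => simpa using h.mul_tgt a
  | src_zero v a hv => simpa using h.src_zero v a hv
  | tgt_zero v a hv => simpa using h.tgt_zero v a hv
  | rel_zero a b hab => simpa using h.rel_zero a b hab

/-- The algebra homomorphism out of `A` determined by the images of the generators. -/
def GARep.hom (h : GARep rel e x) : GA k Q rel →ₐ[k] B :=
  RingQuot.liftAlgHom k ⟨FreeAlgebra.lift k (Sum.elim e x), h.compat⟩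

theorem GARep.hom_vtx (h : GARep rel e x) (v : Q.V) : h.hom (vtx k Q rel v) = e v := by
  simp [GARep.hom, vtx]

theorem GARep.hom_arr (h : GARep rel e x) (a : Q.Arr) : h.hom (arr k Q rel a) = x a := by
  simp [GARep.hom, arr]

end Lift

section Aug

theorem augRep (v : Q.V) :
    GARep rel (fun w => if w = v then (1 : k) else 0) (fun _ => (0 : k)) where
  idem w := by simp
  orth w w' h := by
    by_cases hw : w = v
    · have : w' ≠ v := fun h' => h (hw.trans h'.symm)
      simp [this]
    · simp [hw]
  unit := by simp
  src_mul a := by simp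
  mul_tgt a := by simp
  src_zero v a _ := by simp
  tgt_zero v a _ := by simp
  rel_zero a b _ := by simp

variable (k rel) in
/-- The character of `A` sending a path to `1` if it is stationary at `v`, and to `0` otherwise. -/
def aug (v : Q.V) : GA k Q rel →ₐ[k] k := (augRep (rel := rel) v).hom

@[simp] theorem aug_vtx (v w : Q.V) :
    aug k rel v (vtx k Q rel w) = if w = v then 1 else 0 := GARep.hom_vtx _ _

@[simp] theorem aug_arr (v : Q.V) (a : Q.Arr) : aug k rel v (arr k Q rel a) = 0 :=
  GARep.hom_arr _ _

end Aug

section ArrowRep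

theorem arrowRep (a : Q.Arr) :
    GARep rel
      (fun v => !![if v = Q.src a then (1 : k) else 0, 0; 0, if v = Q.tgt a then 1 else 0])
      (fun b => !![0, if b = a then (1 : k) else 0; 0, 0]) where
  idem v := by
    ext i j
    fin_cases i <;> fin_cases j <;> simp [Matrix.mul_apply]
  orth v w h := by
    ext i j
    fin_cases i <;> fin_cases j <;> simp [Matrix.mul_apply] <;> grind
  unit := by
    ext i j
    fin_cases i <;> fin_cases j <;> simp [Matrix.sum_apply]
  src_mul b := by
    ext i j
    fin_cases i <;> fin_cases j <;> simp [Matrix.mul_apply]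
    grind
  mul_tgt b := by
    ext i j
    fin_cases i <;> fin_cases j <;> simp [Matrix.mul_apply]
    grind
  src_zero v b h := by
    ext i j
    fin_cases i <;> fin_cases j <;> simp [Matrix.mul_apply]
    grind
  tgt_zero v b h := by
    ext i j
    fin_cases i <;> fin_cases j <;> simp [Matrix.mul_apply]
    grind
  rel_zero b c _ := by
    ext i j
    fin_cases i <;> fin_cases j <;> simp [Matrix.mul_apply]

theorem arr_ne_zero (a : Q.Arr) : arr k Q rel a ≠ 0 := by
  intro h
  have h1 := congrArg (fun M : Matrix (Fin 2) (Fin 2) k => M 0 1)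
    ((arrowRep (rel := rel) a).hom_arr (k := k) a)
  simp [h] at h1

theorem arrowRep_hom_apply (a : Q.Arr) (x : GA k Q rel) :
    (arrowRep (k := k) (rel := rel) a).hom x 1 0 = 0 ∧
      (arrowRep (k := k) (rel := rel) a).hom x 0 0 = aug k rel (Q.src a) x := by
  induction x using GA.induction with
  | scalar r => simp [Matrix.algebraMap_matrix_apply]
  | vertex v => simp [GARep.hom_vtx]
  | arrow b => simp [GARep.hom_arr]
  | mul x y hx hy => simp [Matrix.mul_apply, hx, hy]
  | add x y hx hy => simp [hx, hy]

theorem aug_eq_zero_of_mul_arr {a : Q.Arr} {x : GA k Q rel} (h : x * arr k Q rel a = 0) :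
    aug k rel (Q.src a) x = 0 := by
  have h1 := congrArg (fun y => (arrowRep (k := k) (rel := rel) a).hom y 0 1) h
  rw [← (arrowRep_hom_apply a x).2]
  simpa [GARep.hom_arr, Matrix.mul_apply] using h1

end ArrowRep

section Ideals

theorem one_notMem {P : TwoSidedIdeal (GA k Q rel)} (hP : P ≠ ⊤) : (1 : GA k Q rel) ∉ P :=
  fun h => hP (P.eq_top h)

theorem vtx_mem_mIdeal {v w : Q.V} (h : w ≠ v) : vtx k Q rel w ∈ mIdeal k Q rel v :=
  TwoSidedIdeal.subset_span (Or.inl ⟨w, h, rfl⟩)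

theorem arr_mem_mIdeal (v : Q.V) (a : Q.Arr) : arr k Q rel a ∈ mIdeal k Q rel v := by
  by_cases hs : Q.src a = v
  · by_cases ht : Q.tgt a = v
    · exact TwoSidedIdeal.subset_span (Or.inr ⟨a, hs, ht, rfl⟩)
    · have h := arr_mul_vtx (k := k) (rel := rel) (Q.tgt a) a
      rw [if_pos rfl] at h
      rw [← h]
      exact TwoSidedIdeal.mul_mem_left _ _ _ (vtx_mem_mIdeal ht)
  · have h := vtx_mul_arr (k := k) (rel := rel) (Q.src a) a
    rw [if_pos rfl] at h
    rw [← h]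
    exact TwoSidedIdeal.mul_mem_right _ _ _ (vtx_mem_mIdeal hs)

theorem sub_aug_mem_mIdeal (v : Q.V) (x : GA k Q rel) :
    x - algebraMap k _ (aug k rel v x) ∈ mIdeal k Q rel v := by
  induction x using GA.induction with
  | scalar r =>
    rw [AlgHom.commutes]
    simp
  | vertex w =>
    by_cases h : w = v
    · subst h
      have h1 : vtx k Q rel w - algebraMap k _ (aug k rel w (vtx k Q rel w)) =
          -∑ u ∈ Finset.univ.erase w, vtx k Q rel u := by
        rw [eq_neg_iff_add_eq_zero, sub_add_eq_add_sub,
          Finset.add_sum_erase _ _ (Finset.mem_univ w), sum_vtx]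
        simp
      rw [h1]
      exact neg_mem (sum_mem fun u hu => vtx_mem_mIdeal (Finset.ne_of_mem_erase hu))
    · simpa [h] using vtx_mem_mIdeal h
  | arrow a => simpa using arr_mem_mIdeal v a
  | mul x y hx hy =>
    have h : x * y - algebraMap k _ (aug k rel v (x * y)) =
        (x - algebraMap k _ (aug k rel v x)) * y +
          algebraMap k _ (aug k rel v x) * (y - algebraMap k _ (aug k rel v y)) := by
      simp only [map_mul, sub_mul, mul_sub]; abel
    rw [h]
    exact add_mem (TwoSidedIdeal.mul_mem_right _ _ _ hx) (TwoSidedIdeal.mul_mem_left _ _ _ hy)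
  | add x y hx hy =>
    have h : x + y - algebraMap k _ (aug k rel v (x + y)) =
        (x - algebraMap k _ (aug k rel v x)) + (y - algebraMap k _ (aug k rel v y)) := by
      simp only [map_add]; abel
    rw [h]
    exact add_mem hx hy

theorem mem_mIdeal {v : Q.V} {x : GA k Q rel} : x ∈ mIdeal k Q rel v ↔ aug k rel v x = 0 := by
  constructor
  · intro h
    have h1 : mIdeal k Q rel v ≤ TwoSidedIdeal.ker (aug k rel v) := by
      rw [mIdeal, TwoSidedIdeal.span_le]
      rintro y (⟨w, hw, rfl⟩ | ⟨a, -, -, rfl⟩)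
      · exact (TwoSidedIdeal.mem_ker _).2 (by simp [hw])
      · exact (TwoSidedIdeal.mem_ker _).2 (by simp)
    exact (TwoSidedIdeal.mem_ker _).1 (h1 h)
  · intro h
    simpa [h] using sub_aug_mem_mIdeal v x

theorem isPrimeTI_mIdeal (v : Q.V) : IsPrimeTI k Q rel (mIdeal k Q rel v) := by
  refine ⟨fun h => ?_, fun x y h => ?_⟩
  · have h1 : (1 : GA k Q rel) ∈ mIdeal k Q rel v := h ▸ TwoSidedIdeal.mem_top _
    simp [mem_mIdeal] at h1
  · simpa [mem_mIdeal] using h 1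

theorem eq_mIdeal_of_le {P : TwoSidedIdeal (GA k Q rel)} (hP : P ≠ ⊤) {v : Q.V}
    (h : mIdeal k Q rel v ≤ P) : P = mIdeal k Q rel v := by
  refine le_antisymm (fun x hx => ?_) h
  rw [mem_mIdeal]
  by_contra hne
  have h1 : algebraMap k (GA k Q rel) (aug k rel v x) ∈ P := by
    simpa using sub_mem hx (h (sub_aug_mem_mIdeal v x))
  apply one_notMem hP
  have h2 := P.mul_mem_left (algebraMap k _ (aug k rel v x)⁻¹) _ h1
  rwa [← map_mul, inv_mul_cancel₀ hne, map_one] at h2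

/-- A prime ideal containing all arrows is one of the ideals `𝔪_v`. -/
theorem exists_eq_mIdeal {P : TwoSidedIdeal (GA k Q rel)} (hP : IsPrimeTI k Q rel P)
    (h : ∀ a, arr k Q rel a ∈ P) : ∃ v, P = mIdeal k Q rel v := by
  obtain ⟨v, hv⟩ : ∃ v, vtx k Q rel v ∉ P := by
    by_contra! hall
    exact one_notMem hP.1 (sum_vtx (k := k) (rel := rel) ▸ sum_mem fun v _ => hall v)
  have key : ∀ x, vtx k Q rel v * x - algebraMap k _ (aug k rel v x) * vtx k Q rel v ∈ P := by
    intro x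
    induction x using GA.induction with
    | scalar r =>
      rw [AlgHom.commutes, ← Algebra.commutes]
      simp
    | vertex w =>
      by_cases hw : w = v
      · subst hw
        simp [vtx_mul_self]
      · simp [hw, vtx_mul_vtx_of_ne (Ne.symm hw)]
    | arrow a => simpa using P.mul_mem_left _ _ (h a)
    | mul x y hx hy =>
      have h : vtx k Q rel v * (x * y) - algebraMap k _ (aug k rel v (x * y)) * vtx k Q rel v =
          (vtx k Q rel v * x - algebraMap k _ (aug k rel v x) * vtx k Q rel v) * y +
          algebraMap k _ (aug k rel v x) *
            (vtx k Q rel v * y - algebraMap k _ (aug k rel v y) * vtx k Q rel v) := by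
        simp only [map_mul, sub_mul, mul_sub, mul_assoc]; abel
      rw [h]
      exact add_mem (P.mul_mem_right _ _ hx) (P.mul_mem_left _ _ hy)
    | add x y hx hy =>
      have h : vtx k Q rel v * (x + y) - algebraMap k _ (aug k rel v (x + y)) * vtx k Q rel v =
          (vtx k Q rel v * x - algebraMap k _ (aug k rel v x) * vtx k Q rel v) +
            (vtx k Q rel v * y - algebraMap k _ (aug k rel v y) * vtx k Q rel v) := by
        simp only [map_add, add_mul, mul_add]; abel
      rw [h]
      exact add_mem hx hy
  refine ⟨v, eq_mIdeal_of_le hP.1 fun y hy => (hP.2 _ _ fun a => ?_).resolve_left hv⟩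
  rw [mem_mIdeal] at hy
  simpa [hy, mul_assoc] using key (a * y)

end Ideals

end General

set_option linter.unusedSectionVars false

section Cycle

variable {k : Type} [Field k] {Q : Quiv} {rel : Q.Arr → Q.Arr → Prop}
variable {n : ℕ} [NeZero n] {f : ZMod n → Q.Arr}

/-- A cyclic arrangement of distinct arrows whose consecutive products are nonzero in `A`. -/
structure ArrowCycle (rel : Q.Arr → Q.Arr → Prop) (f : ZMod n → Q.Arr) : Prop where
  gentle : IsGentleRel Q rel
  inj : Function.Injective f
  comp : ∀ i, Q.tgt (f i) = Q.src (f (i + 1))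
  not_rel : ∀ i, ¬ rel (f i) (f (i + 1))

variable (k rel f) in
/-- The path of length `l` along the cycle `f`, starting with the arrow `f i`. -/
def cyclePath : ZMod n → ℕ → GA k Q rel
  | _, 0 => 1
  | i, l + 1 => arr k Q rel (f i) * cyclePath (i + 1) l

variable (k rel f) in
/-- The sum of all rotations of the cycle `f`. -/
def cycleSum : GA k Q rel := ∑ i, cyclePath k rel f i n

variable (k rel f) in
/-- The span of the paths along `f` of positive length which can be continued by `f j`. -/
def pathSpan (j : ZMod n) : Submodule k (GA k Q rel) :=
  Submodule.span k (Set.range fun l : ℕ => cyclePath k rel f (j - (l + 1 : ℕ)) (l + 1))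

local notation "cp" => cyclePath k rel f
local notation "cm" => cycleSum k rel f

theorem cyclePath_one (i : ZMod n) : cp i 1 = arr k Q rel (f i) := by
  simp [cyclePath]

theorem cyclePath_add (i : ZMod n) (l l' : ℕ) : cp i (l + l') = cp i l * cp (i + l) l' := by
  induction l generalizing i with
  | zero => simp [cyclePath]
  | succ l ih =>
    rw [show l + 1 + l' = (l + l') + 1 by ring, cyclePath, ih, cyclePath, mul_assoc]
    congr 3
    push_cast; ring

theorem cyclePath_succ (i : ZMod n) (l : ℕ) :
    cp i (l + 1) = cp i l * arr k Q rel (f (i + l)) := by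
  rw [cyclePath_add, cyclePath_one]

theorem cyclePath_mul {i j : ZMod n} {l l' : ℕ} (h : i + l = j) :
    cp i l * cp j l' = cp i (l + l') := by
  rw [cyclePath_add, h]

theorem cyclePath_mem_pathSpan {i j : ZMod n} {l : ℕ} (hl : 0 < l) (h : i + l = j) :
    cp i l ∈ pathSpan k rel f j := by
  obtain ⟨l, rfl⟩ : ∃ l', l = l' + 1 := ⟨l - 1, by omega⟩
  refine Submodule.subset_span ⟨l, ?_⟩
  subst h
  simp

namespace ArrowCycle

variable (hf : ArrowCycle rel f)
include hf

theorem eq_of_mul_ne_zero_left {b : Q.Arr} {i : ZMod n}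
    (h : arr k Q rel b * arr k Q rel (f i) ≠ 0) : b = f (i - 1) := by
  by_contra hne
  obtain ⟨h1, h2⟩ := allowed_of_arr_mul_arr_ne_zero h
  have h3 := hf.comp (i - 1)
  have h4 := hf.not_rel (i - 1)
  rw [sub_add_cancel] at h3 h4
  rcases hf.gentle.cond_ii (f i) b (f (i - 1)) hne h1 h3 with h5 | h5
  · exact h2 h5.1
  · exact h4 h5.1

theorem eq_of_mul_ne_zero_right {b : Q.Arr} {i : ZMod n}
    (h : arr k Q rel (f i) * arr k Q rel b ≠ 0) : b = f (i + 1) := by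
  by_contra hne
  obtain ⟨h1, h2⟩ := allowed_of_arr_mul_arr_ne_zero h
  rcases hf.gentle.cond_iii (f i) b (f (i + 1)) hne h1 (hf.comp i) with h5 | h5
  · exact h2 h5.1
  · exact hf.not_rel i h5.1

theorem cyclePath_mul_of_ne {i j : ZMod n} {l l' : ℕ} (hl : 0 < l) (hl' : 0 < l')
    (h : i + l ≠ j) : cp i l * cp j l' = 0 := by
  obtain ⟨l, rfl⟩ : ∃ r, l = r + 1 := ⟨l - 1, by omega⟩
  obtain ⟨l', rfl⟩ : ∃ r, l' = r + 1 := ⟨l' - 1, by omega⟩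
  have h0 : arr k Q rel (f (i + l)) * arr k Q rel (f j) = 0 := by
    by_contra h1
    have h2 := hf.inj (hf.eq_of_mul_ne_zero_left h1)
    apply h
    push_cast
    rw [← add_assoc, h2, sub_add_cancel]
  rw [cyclePath_succ, cyclePath, mul_assoc, ← mul_assoc (arr k Q rel _), h0]
  simp

omit hf in
theorem vtx_mul_cyclePath (v : Q.V) (i : ZMod n) {l : ℕ} (hl : 0 < l) :
    vtx k Q rel v * cp i l = if v = Q.src (f i) then cp i l else 0 := by
  obtain ⟨l, rfl⟩ : ∃ r, l = r + 1 := ⟨l - 1, by omega⟩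
  rw [cyclePath, ← mul_assoc, vtx_mul_arr]
  split_ifs <;> simp

theorem cyclePath_mul_vtx (v : Q.V) (i : ZMod n) {l : ℕ} (hl : 0 < l) :
    cp i l * vtx k Q rel v = if v = Q.src (f (i + l)) then cp i l else 0 := by
  obtain ⟨l, rfl⟩ : ∃ r, l = r + 1 := ⟨l - 1, by omega⟩
  rw [cyclePath_succ, mul_assoc, arr_mul_vtx, hf.comp]
  push_cast
  rw [add_assoc]
  split_ifs <;> simp

theorem mul_mem_pathSpan {j : ZMod n} (x : GA k Q rel) {y : GA k Q rel}
    (hy : y ∈ pathSpan k rel f j) : x * y ∈ pathSpan k rel f j := by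
  refine mul_mem_of_generators (fun v y hy => ?_) (fun a y hy => ?_) x y hy
  · induction hy using Submodule.span_induction with
    | mem y hy =>
      obtain ⟨l, rfl⟩ := hy
      simp only
      rw [vtx_mul_cyclePath _ _ (Nat.succ_pos l)]
      split_ifs
      · exact Submodule.subset_span ⟨l, rfl⟩
      · exact zero_mem _
    | zero => simp
    | add y z _ _ hy hz => rw [mul_add]; exact add_mem hy hz
    | smul r y _ hy => rw [mul_smul_comm]; exact Submodule.smul_mem _ _ hy
  · induction hy using Submodule.span_induction with
    | mem y hy =>
      obtain ⟨l, rfl⟩ := hy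
      simp only
      by_cases h : arr k Q rel a * arr k Q rel (f (j - (l + 1 : ℕ))) = 0
      · rw [cyclePath, ← mul_assoc, h, zero_mul]
        exact zero_mem _
      · rw [hf.eq_of_mul_ne_zero_left h, ← cyclePath_one, cyclePath_mul (by simp)]
        exact cyclePath_mem_pathSpan (by omega) (by push_cast; ring)
    | zero => simp
    | add y z _ _ hy hz => rw [mul_add]; exact add_mem hy hz
    | smul r y _ hy => rw [mul_smul_comm]; exact Submodule.smul_mem _ _ hy

theorem cyclePath_mul_cycleSum (i : ZMod n) {l : ℕ} (hl : 0 < l) :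
    cp i l * cm = cp i (l + n) := by
  rw [cycleSum, Finset.mul_sum, Finset.sum_eq_single (i + l), cyclePath_mul rfl]
  · intro j _ hj
    exact hf.cyclePath_mul_of_ne hl (NeZero.pos n) hj.symm
  · simp

theorem cycleSum_mul_cyclePath (i : ZMod n) {l : ℕ} (hl : 0 < l) :
    cm * cp i l = cp i (l + n) := by
  rw [cycleSum, Finset.sum_mul, Finset.sum_eq_single i, cyclePath_mul (by simp), add_comm]
  · intro j _ hj
    exact hf.cyclePath_mul_of_ne (NeZero.pos n) hl (by simpa using hj)
  · simp

theorem commute_cycleSum (x : GA k Q rel) : Commute x cm := by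
  have hn := NeZero.pos n
  induction x using GA.induction with
  | scalar r => exact Algebra.commutes r _
  | vertex v =>
    rw [Commute, SemiconjBy, cycleSum, Finset.mul_sum, Finset.sum_mul]
    refine Finset.sum_congr rfl fun i _ => ?_
    rw [vtx_mul_cyclePath _ _ hn, hf.cyclePath_mul_vtx _ _ hn]
    simp
  | arrow a =>
    by_cases ha : ∃ i, a = f i
    · obtain ⟨i, rfl⟩ := ha
      rw [Commute, SemiconjBy, ← cyclePath_one, hf.cyclePath_mul_cycleSum _ one_pos,
        hf.cycleSum_mul_cyclePath _ one_pos]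
    · obtain ⟨r, hr⟩ : ∃ r, n = r + 1 := ⟨n - 1, by omega⟩
      have h1 : arr k Q rel a * cm = 0 := by
        rw [cycleSum, Finset.mul_sum]
        refine Finset.sum_eq_zero fun i _ => ?_
        have h0 : arr k Q rel a * arr k Q rel (f i) = 0 := by
          by_contra h0
          exact ha ⟨_, hf.eq_of_mul_ne_zero_left h0⟩
        obtain ⟨r, hr⟩ : ∃ r, n = r + 1 := ⟨n - 1, by omega⟩
        have h2 : cp i n = arr k Q rel (f i) * cp (i + 1) r := by
          conv_lhs => rw [show cp i n = cp i (r + 1) from congrArg _ hr]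
          rw [cyclePath]
        rw [h2, ← mul_assoc, h0, zero_mul]
      have h2 : cm * arr k Q rel a = 0 := by
        rw [cycleSum, Finset.sum_mul]
        refine Finset.sum_eq_zero fun i _ => ?_
        have h0 : arr k Q rel (f (i + r)) * arr k Q rel a = 0 := by
          by_contra h0
          exact ha ⟨_, hf.eq_of_mul_ne_zero_right h0⟩
        have h2 : cp i n = cp i r * arr k Q rel (f (i + r)) := by
          conv_lhs => rw [show cp i n = cp i (r + 1) from congrArg _ hr]
          rw [cyclePath_succ]
        rw [h2, mul_assoc, h0, mul_zero]
      rw [Commute, SemiconjBy, h1, h2]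
  | mul x y hx hy => exact hx.mul_left hy
  | add x y hx hy => exact hx.add_left hy

theorem commute_aeval (g : Polynomial k) (x : GA k Q rel) : Commute x (Polynomial.aeval cm g) := by
  induction g using Polynomial.induction_on' with
  | add p q hp hq => rw [map_add]; exact hp.add_right hq
  | monomial l r =>
    rw [Polynomial.aeval_monomial]
    exact (Algebra.commute_algebraMap_right r x).mul_right ((hf.commute_cycleSum x).pow_right l)

theorem cyclePath_mul_cycleSum_pow (i : ZMod n) {l : ℕ} (hl : 0 < l) (q : ℕ) :
    cp i l * cm ^ q = cp i (l + n * q) := by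
  induction q with
  | zero => simp
  | succ q ih =>
    rw [pow_succ, ← mul_assoc, ih, hf.cyclePath_mul_cycleSum _ (by omega)]
    congr 1
    ring

/-- Multiplying a closed element of `pathSpan` by a path yields a multiple of that path by a
polynomial in the central element. -/
theorem exists_cyclePath_mul_eq {j : ZMod n} {y : GA k Q rel} (hy : y ∈ pathSpan k rel f j)
    {i : ZMod n} {l : ℕ} (hl : 0 < l) (h : i + l = j) :
    ∃ g : Polynomial k, cp i l * y = cp i l * (cm * Polynomial.aeval cm g) := by
  induction hy using Submodule.span_induction with
  | mem y hy =>
    obtain ⟨r, rfl⟩ := hy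
    simp only
    by_cases hr : j = j - (r + 1 : ℕ)
    · have h1 : n ∣ r + 1 := by
        rw [← ZMod.natCast_eq_zero_iff]
        rw [eq_comm, sub_eq_self] at hr
        exact hr
      obtain ⟨q, hq⟩ := h1
      obtain ⟨q, rfl⟩ : ∃ q', q = q' + 1 := ⟨q - 1, by
        rcases q with _ | q
        · simp at hq
        · simp⟩
      refine ⟨Polynomial.X ^ q, ?_⟩
      rw [cyclePath_mul (h.trans hr), map_pow, Polynomial.aeval_X, ← pow_succ',
        hf.cyclePath_mul_cycleSum_pow _ hl, hq]
    · refine ⟨0, ?_⟩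
      rw [hf.cyclePath_mul_of_ne hl (Nat.succ_pos r) (h ▸ hr)]
      simp
  | zero => exact ⟨0, by simp⟩
  | add y z _ _ hy hz =>
    obtain ⟨g, hg⟩ := hy
    obtain ⟨g', hg'⟩ := hz
    exact ⟨g + g', by rw [mul_add, hg, hg', map_add, mul_add, mul_add]⟩
  | smul r y _ hy =>
    obtain ⟨g, hg⟩ := hy
    exact ⟨r • g, by rw [mul_smul_comm, hg, map_smul, mul_smul_comm, mul_smul_comm]⟩

end ArrowCycle

end Cycle

section CycleRep

theorem isCoprime_X_pow {k : Type*} [Field k] {p : Polynomial k} (h : p.coeff 0 ≠ 0)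
    (s : ℕ) : IsCoprime p (Polynomial.X ^ s) := by
  refine (IsCoprime.pow_left ?_).symm
  rw [Polynomial.irreducible_X.coprime_iff_not_dvd, Polynomial.X_dvd_iff]
  exact h

theorem expand_dvd_expand_of_irreducible {k : Type*} [Field k] {p g : Polynomial k}
    (hp : Irreducible p) {n : ℕ} (hn : 0 < n) :
    Polynomial.expand k n p ∣ Polynomial.expand k n g ↔ p ∣ g := by
  refine ⟨fun h => ?_, fun h => map_dvd (Polynomial.expand k n) h⟩
  by_contra h1
  have h2 := (hp.coprime_iff_not_dvd.2 h1).map (Polynomial.expand k n).toRingHom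
  have h3 : IsUnit (Polynomial.expand k n p) := h2.isUnit_of_dvd' dvd_rfl h
  have h4 := Polynomial.natDegree_eq_zero_of_isUnit h3
  rw [Polynomial.natDegree_expand] at h4
  exact (Nat.mul_pos hp.natDegree_pos hn).ne' h4

variable {k : Type} [Field k] {Q : Quiv} {rel : Q.Arr → Q.Arr → Prop}
variable {n : ℕ} [NeZero n] {f : ZMod n → Q.Arr}

local notation "cp" => cyclePath k rel f
local notation "cm" => cycleSum k rel f

namespace ArrowCycle

variable (hf : ArrowCycle rel f)

include hf in
theorem isRep : GARep rel
    (fun v => Matrix.diagonal fun i => if Q.src (f i) = v then (1 : Polynomial k) else 0)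
    (fun a => Matrix.of fun i j => if f i = a ∧ j = i + 1 then (Polynomial.X : Polynomial k)
      else 0) where
  idem v := by simp
  orth v w h := by
    rw [Matrix.diagonal_mul_diagonal, ← Matrix.diagonal_zero]
    congr 1
    ext1 i
    grind
  unit := by
    ext1 i j
    by_cases h : i = j
    · subst h
      simp [Matrix.sum_apply]
    · simp [Matrix.sum_apply, h]
  src_mul a := by
    ext1 i j
    rw [Matrix.diagonal_mul]
    simp only [Matrix.of_apply]
    grind
  mul_tgt a := by
    ext1 i j
    rw [Matrix.mul_diagonal]
    simp only [Matrix.of_apply]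
    have := hf.comp i
    grind
  src_zero v a h := by
    ext1 i j
    rw [Matrix.diagonal_mul]
    simp only [Matrix.of_apply, Matrix.zero_apply]
    grind
  tgt_zero v a h := by
    ext1 i j
    rw [Matrix.mul_diagonal]
    simp only [Matrix.of_apply, Matrix.zero_apply]
    have := hf.comp i
    grind
  rel_zero a b hab := by
    ext1 i j
    rw [Matrix.mul_apply, Matrix.zero_apply]
    refine Finset.sum_eq_zero fun l _ => ?_
    simp only [Matrix.of_apply]
    have := hf.not_rel i
    grind

variable (k) in
/-- The representation of `A` by polynomial matrices attached to a cycle. -/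
def rho : GA k Q rel →ₐ[k] Matrix (ZMod n) (ZMod n) (Polynomial k) := hf.isRep.hom

include hf

theorem rho_vtx (v : Q.V) : hf.rho k (vtx k Q rel v) =
    Matrix.diagonal fun i => if Q.src (f i) = v then (1 : Polynomial k) else 0 :=
  GARep.hom_vtx _ _

theorem rho_arr (a : Q.Arr) : hf.rho k (arr k Q rel a) =
    Matrix.of fun i j => if f i = a ∧ j = i + 1 then (Polynomial.X : Polynomial k) else 0 :=
  GARep.hom_arr _ _

theorem rho_arr_eq_zero {a : Q.Arr} (h : ∀ i, f i ≠ a) : hf.rho k (arr k Q rel a) = 0 := by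
  ext1 i j
  simp [rho_arr, h i]

theorem rho_cyclePath (i : ZMod n) {l : ℕ} (hl : 0 < l) :
    hf.rho k (cp i l) = Matrix.single i (i + l) (Polynomial.X ^ l) := by
  have h1 : ∀ i, hf.rho k (arr k Q rel (f i)) = Matrix.single i (i + 1) Polynomial.X := by
    intro i
    ext1 a b
    rw [rho_arr, Matrix.of_apply, Matrix.single_apply]
    have := @hf.inj a i
    grind
  obtain ⟨l, rfl⟩ : ∃ r, l = r + 1 := ⟨l - 1, by omega⟩
  clear hl
  induction l generalizing i with
  | zero => simp [cyclePath_one, h1]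
  | succ l ih =>
    rw [cyclePath, map_mul, ih, h1, Matrix.single_mul_single_same, ← pow_succ']
    congr 1
    push_cast
    ring

theorem rho_cycleSum : hf.rho k cm = algebraMap (Polynomial k) _ (Polynomial.X ^ n) := by
  rw [cycleSum, map_sum, Matrix.algebraMap_eq_diagonal]
  ext1 i j
  rw [Matrix.sum_apply]
  simp only [hf.rho_cyclePath _ (NeZero.pos n), Matrix.single_apply, Matrix.diagonal_apply,
    CharP.cast_eq_zero, add_zero]
  by_cases h : i = j
  · subst h
    simp
  · rw [if_neg h]
    exact Finset.sum_eq_zero fun l _ => if_neg fun hl => h (hl.1.symm.trans hl.2)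

theorem rho_aeval (p : Polynomial k) : hf.rho k (Polynomial.aeval cm p) =
    algebraMap (Polynomial k) _ (Polynomial.expand k n p) := by
  rw [← Polynomial.aeval_algHom_apply, rho_cycleSum, Polynomial.aeval_algebraMap_apply]
  rfl

/-- The representation is faithful on each of the left ideals `pathSpan k rel f j`. -/
theorem eq_zero_of_mem_pathSpan {j : ZMod n} {y : GA k Q rel} (hy : y ∈ pathSpan k rel f j)
    (h : hf.rho k y = 0) : y = 0 := by
  obtain ⟨c, rfl⟩ := Finsupp.mem_span_range_iff_exists_finsupp.1 hy
  suffices hc : c = 0 by simp [hc]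
  ext l
  have h1 := congrArg (fun M : Matrix (ZMod n) (ZMod n) (Polynomial k) =>
    (∑ i, M i j).coeff (l + 1)) h
  simp only [Finsupp.sum, map_sum, map_smul, hf.rho_cyclePath _ (Nat.succ_pos _),
    sub_add_cancel, Matrix.sum_apply, Matrix.smul_apply, Matrix.zero_apply] at h1
  rw [Finset.sum_comm] at h1
  simpa [Matrix.single_apply, Polynomial.coeff_X_pow, Polynomial.finsetSum_coeff,
    ← Finset.smul_sum, eq_comm] using h1

theorem rho_apply_of_mem_pathSpan {j : ZMod n} {y : GA k Q rel} (hy : y ∈ pathSpan k rel f j)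
    (i : ZMod n) {j' : ZMod n} (h : j' ≠ j) : hf.rho k y i j' = 0 := by
  induction hy using Submodule.span_induction with
  | mem y hy =>
    obtain ⟨l, rfl⟩ := hy
    simp only [hf.rho_cyclePath _ (Nat.succ_pos _), sub_add_cancel]
    rw [Matrix.single_apply_of_col_ne _ _ h.symm]
  | zero => simp
  | add y z _ _ hy hz => simp [hy, hz]
  | smul r y _ hy => simp [hy]

omit hf in
theorem arr_mem_pathSpan (i : ZMod n) : arr k Q rel (f i) ∈ pathSpan k rel f (i + 1) := by
  rw [← cyclePath_one]
  exact cyclePath_mem_pathSpan one_pos (by simp)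

theorem mul_arr_eq_zero {x : GA k Q rel} (hx : hf.rho k x = 0) (i : ZMod n) :
    x * arr k Q rel (f i) = 0 :=
  hf.eq_zero_of_mem_pathSpan (hf.mul_mem_pathSpan x (arr_mem_pathSpan i)) (by simp [hx])

theorem mem_annJ {c : List Q.Arr} (hc : ∀ a, a ∈ c ↔ ∃ i, f i = a) {x : GA k Q rel} :
    x ∈ annJ k Q rel c ↔ hf.rho k x = 0 := by
  constructor
  · intro h
    ext1 i j
    have h1 : x * arr k Q rel (f j) = 0 :=
      h _ (TwoSidedIdeal.subset_span ⟨f j, (hc _).2 ⟨j, rfl⟩, rfl⟩)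
    have h2 := congrFun (congrFun (congrArg (hf.rho k) h1) i) (j + 1)
    rw [← cyclePath_one, map_mul, hf.rho_cyclePath _ one_pos] at h2
    simpa using h2
  · intro h y hy
    induction hy using TwoSidedIdeal.span_induction generalizing x with
    | mem y hy =>
      obtain ⟨a, ha, rfl⟩ := hy
      obtain ⟨i, rfl⟩ := (hc a).1 ha
      exact hf.mul_arr_eq_zero h i
    | zero => simp
    | add y z _ _ hy hz => rw [mul_add, hy h, hz h, add_zero]
    | neg y _ hy => exact (mul_neg x y).trans (by rw [hy h, neg_zero])
    | left_absorb a y _ hy => rw [← mul_assoc]; exact hy (by simp [h])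
    | right_absorb b y _ hy => rw [← mul_assoc, hy h, zero_mul]

theorem rho_mul_cyclePath_mul (x y : GA k Q rel) (a b d : ZMod n) {l : ℕ} (hl : 0 < l) :
    hf.rho k (x * cp b l * y) a d =
      hf.rho k x a b * Polynomial.X ^ l * hf.rho k y (b + l) d := by
  rw [map_mul, map_mul, hf.rho_cyclePath _ hl, mul_assoc, Matrix.mul_apply,
    Finset.sum_eq_single b]
  · rw [Matrix.single_mul_apply_same, mul_assoc]
  · intro i _ hi
    rw [Matrix.single_mul_apply_of_ne _ _ _ _ _ hi, mul_zero]
  · simp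

omit hf in
theorem add_val_sub (a b : ZMod n) : b + ((a - b).val : ℕ) = a := by
  rw [ZMod.natCast_zmod_val]; ring

/-- The kernel of the representation is a prime ideal. -/
theorem isPrimeTI_of_mem_iff {P : TwoSidedIdeal (GA k Q rel)}
    (hP : ∀ x, x ∈ P ↔ hf.rho k x = 0) : IsPrimeTI k Q rel P := by
  refine ⟨fun h => ?_, fun x y h => ?_⟩
  · have h1 : (1 : GA k Q rel) ∈ P := h ▸ TwoSidedIdeal.mem_top _
    rw [hP, map_one] at h1
    exact one_ne_zero h1
  · by_contra! hxy
    simp only [hP] at hxy h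
    obtain ⟨a, b, hab⟩ : ∃ a b, hf.rho k x a b ≠ 0 := by
      by_contra! h0
      exact hxy.1 (Matrix.ext h0)
    obtain ⟨c, d, hcd⟩ : ∃ c d, hf.rho k y c d ≠ 0 := by
      by_contra! h0
      exact hxy.2 (Matrix.ext h0)
    have h1 := congrFun (congrFun (h (cp b ((c - b).val + n))) a) d
    rw [hf.rho_mul_cyclePath_mul _ _ _ _ _ (by have := NeZero.pos n; omega)] at h1
    rw [Nat.cast_add, ← add_assoc, add_val_sub] at h1
    simp [hab, hcd] at h1

theorem exists_cyclePath_mul_mul_eq (x : GA k Q rel) (a b : ZMod n) : ∃ g : Polynomial k,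
    cp a n * (x * cp b ((a - b).val + n)) = cp a n * (cm * Polynomial.aeval cm g) ∧
      hf.rho k x a b * Polynomial.X ^ (a - b).val = Polynomial.expand k n g := by
  have hn := NeZero.pos n
  have hw : cp b ((a - b).val + n) ∈ pathSpan k rel f a :=
    cyclePath_mem_pathSpan (by omega) (by push_cast; rw [← add_assoc, add_val_sub]; simp)
  obtain ⟨g, hg⟩ := hf.exists_cyclePath_mul_eq (hf.mul_mem_pathSpan x hw) hn
    (i := a) (by simp)
  refine ⟨g, hg, ?_⟩
  have h1 := congrFun (congrFun (congrArg (hf.rho k) hg) a) a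
  have h2 := hf.rho_mul_cyclePath_mul (cp a n * x) 1 a b a (l := (a - b).val + n) (by omega)
  have h3 := hf.rho_mul_cyclePath_mul 1 x a a b (l := n) hn
  rw [← mul_assoc, ← mul_one (cp a n * x * _), h2] at h1
  rw [one_mul] at h3
  rw [h3, Nat.cast_add, ← add_assoc, add_val_sub] at h1
  rw [map_mul, map_mul, rho_cycleSum, rho_aeval, ← map_mul, hf.rho_cyclePath _ hn,
    Matrix.single_mul_apply_same] at h1
  simp only [map_one, CharP.cast_eq_zero, add_zero, Matrix.one_apply_eq, one_mul, mul_one,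
    Matrix.algebraMap_matrix_apply, if_true, Algebra.algebraMap_self, RingHom.id_apply] at h1
  have h4 : (Polynomial.X : Polynomial k) ^ (n + n) ≠ 0 := pow_ne_zero _ Polynomial.X_ne_zero
  apply mul_left_cancel₀ h4
  rw [pow_add, mul_assoc, mul_assoc, ← h1]
  ring

theorem cycleSum_pow_mul_mem {P : TwoSidedIdeal (GA k Q rel)} {z : GA k Q rel}
    (hz : ∀ y, Commute y z) {a : ZMod n} (h : cp a n * z ∈ P) : cm ^ 3 * z ∈ P := by
  have hn := NeZero.pos n
  have h1 : cm ^ 3 = ∑ d, cp d (n + n * 2) := by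
    rw [pow_succ', cycleSum, Finset.sum_mul]
    exact Finset.sum_congr rfl fun d _ => hf.cyclePath_mul_cycleSum_pow d hn 2
  rw [h1, Finset.sum_mul]
  refine sum_mem fun d _ => ?_
  have hd := ZMod.val_lt (a - d)
  have h2 : cp d (n + n * 2) = cp d (a - d).val * (cp a n * cp a (2 * n - (a - d).val)) := by
    rw [cyclePath_mul (by simp), cyclePath_mul (add_val_sub a d)]
    congr 1
    omega
  rw [h2, mul_assoc, mul_assoc, (hz _).eq, ← mul_assoc (cp a n)]
  exact P.mul_mem_left _ _ (P.mul_mem_right _ _ h)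

theorem cycleSum_pow_mul_mem' {P : TwoSidedIdeal (GA k Q rel)} {x : GA k Q rel}
    (h : ∀ a b, cp a n * (x * cp b ((a - b).val + n)) ∈ P) : cm ^ 3 * x ∈ P := by
  have hn := NeZero.pos n
  have h1 : cm ^ 3 * x = ∑ a, ∑ b, cp a n * (x * (cp b n * cm)) := by
    have h2 : ∑ a, ∑ b, cp a n * (x * (cp b n * cm)) = cm * (x * (cm * cm)) := by
      simp only [← Finset.mul_sum, ← Finset.sum_mul]
      rfl
    rw [h2, ← ((hf.commute_cycleSum x).symm.mul_left (hf.commute_cycleSum x).symm).eq]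
    simp only [pow_succ, pow_zero, one_mul, mul_assoc]
  rw [h1]
  refine sum_mem fun a _ => sum_mem fun b _ => ?_
  have hd := ZMod.val_lt (a - b)
  have h2 : cp b n * cm = cp b ((a - b).val + n) * cp a (n - (a - b).val) := by
    rw [hf.cyclePath_mul_cycleSum _ hn, cyclePath_mul]
    · congr 1
      omega
    · push_cast
      rw [← add_assoc, add_val_sub]
      simp
  rw [h2, ← mul_assoc x, ← mul_assoc]
  exact P.mul_mem_right _ _ (h a b)

end ArrowCycle

end CycleRep

section CyclePrimes

variable {k : Type} [Field k] {Q : Quiv} {rel : Q.Arr → Q.Arr → Prop}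
variable {n : ℕ} [NeZero n] {f : ZMod n → Q.Arr}

local notation "cp" => cyclePath k rel f
local notation "cm" => cycleSum k rel f

theorem not_dvd_X_pow {p : Polynomial k} (hp : Irreducible p) (h : p.coeff 0 ≠ 0) (s : ℕ) :
    ¬ p ∣ Polynomial.X ^ s := fun h1 =>
  hp.not_isUnit ((isCoprime_X_pow h s).isUnit_of_dvd' dvd_rfl h1)

namespace ArrowCycle

variable (hf : ArrowCycle rel f)

theorem expand_dvd_iff {p g r : Polynomial k} (hp : Irreducible p) (h0 : p.coeff 0 ≠ 0) {s : ℕ}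
    (h : r * Polynomial.X ^ s = Polynomial.expand k n g) :
    Polynomial.expand k n p ∣ r ↔ p ∣ g := by
  have hn := NeZero.pos n
  rw [← expand_dvd_expand_of_irreducible hp hn, ← h]
  refine ⟨fun h1 => h1.mul_right _, fun h1 => ?_⟩
  refine (isCoprime_X_pow ?_ s).dvd_of_dvd_mul_right h1
  rwa [← Nat.zero_mul n, Polynomial.coeff_expand_mul hn]

include hf

theorem isPrimeTI_of_mem_iff_dvd {P : TwoSidedIdeal (GA k Q rel)} {p : Polynomial k}
    (hp : Irreducible p) (h0 : p.coeff 0 ≠ 0)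
    (hP : ∀ x, x ∈ P ↔ ∀ a b, Polynomial.expand k n p ∣ hf.rho k x a b) :
    IsPrimeTI k Q rel P := by
  have hn := NeZero.pos n
  refine ⟨fun h => ?_, fun x y h => ?_⟩
  · have h1 : (1 : GA k Q rel) ∈ P := h ▸ TwoSidedIdeal.mem_top _
    rw [hP, map_one] at h1
    have h2 := h1 0 0
    rw [Matrix.one_apply_eq, ← map_one (Polynomial.expand k n),
      expand_dvd_expand_of_irreducible hp hn] at h2
    exact hp.not_isUnit (isUnit_of_dvd_one h2)
  · by_contra! hxy
    simp only [hP] at hxy h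
    push Not at hxy
    obtain ⟨⟨a, b, hab⟩, c, d, hcd⟩ := hxy
    obtain ⟨g, -, hg⟩ := hf.exists_cyclePath_mul_mul_eq x a b
    obtain ⟨g', -, hg'⟩ := hf.exists_cyclePath_mul_mul_eq y c d
    rw [expand_dvd_iff hp h0 hg] at hab
    rw [expand_dvd_iff hp h0 hg'] at hcd
    have h1 := h (cp b ((c - b).val + n)) a d
    rw [hf.rho_mul_cyclePath_mul _ _ _ _ _ (by omega), Nat.cast_add, ← add_assoc, add_val_sub,
      ZMod.natCast_self, add_zero] at h1
    set l := (c - b).val + n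
    have h2 : hf.rho k x a b * Polynomial.X ^ l * hf.rho k y c d *
        Polynomial.X ^ ((a - b).val + (c - d).val + (n - 1) * l) =
          Polynomial.expand k n (g * Polynomial.X ^ l * g') := by
      have h3 : l + (n - 1) * l = n * l := by
        obtain ⟨r, hr⟩ : ∃ r, n = r + 1 := ⟨n - 1, by omega⟩
        rw [hr, Nat.add_sub_cancel]
        ring
      rw [map_mul, map_mul, ← hg, ← hg', map_pow, Polynomial.expand_X, ← pow_mul, ← h3]
      ring
    rw [expand_dvd_iff hp h0 h2, hp.prime.dvd_mul, hp.prime.dvd_mul] at h1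
    rcases h1 with (h1 | h1) | h1
    · exact hab h1
    · exact not_dvd_X_pow hp h0 _ h1
    · exact hcd h1

omit hf in
theorem mem_of_cycleSum_pow_mul_mem {P : TwoSidedIdeal (GA k Q rel)} {p : Polynomial k}
    (h0 : p.coeff 0 ≠ 0) (hpP : Polynomial.aeval cm p ∈ P) {x : GA k Q rel} {s : ℕ}
    (hx : cm ^ s * x ∈ P) : x ∈ P := by
  obtain ⟨u, v, huv⟩ := isCoprime_X_pow h0 s
  have h1 := congrArg (fun q => Polynomial.aeval cm q * x) huv
  simp only [map_add, map_mul, map_one, one_mul, map_pow, Polynomial.aeval_X] at h1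
  rw [← h1, add_mul, mul_assoc _ (cm ^ s)]
  exact add_mem (P.mul_mem_right _ _ (P.mul_mem_left _ _ hpP)) (P.mul_mem_left _ _ hx)

theorem mem_of_dvd {P : TwoSidedIdeal (GA k Q rel)} {p : Polynomial k}
    (hp : Irreducible p) (h0 : p.coeff 0 ≠ 0) (hpP : Polynomial.aeval cm p ∈ P) {x : GA k Q rel}
    (hx : ∀ a b, Polynomial.expand k n p ∣ hf.rho k x a b) : x ∈ P := by
  refine mem_of_cycleSum_pow_mul_mem h0 hpP (hf.cycleSum_pow_mul_mem' fun a b => ?_) (s := 3)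
  obtain ⟨g, hg1, hg⟩ := hf.exists_cyclePath_mul_mul_eq x a b
  obtain ⟨g', rfl⟩ := (expand_dvd_iff hp h0 hg).1 (hx a b)
  rw [hg1, map_mul]
  exact P.mul_mem_left _ _ (P.mul_mem_left _ _ (P.mul_mem_right _ _ hpP))

theorem mem_span_iff {c : List Q.Arr} (hc : ∀ a, a ∈ c ↔ ∃ i, f i = a) {p : Polynomial k}
    (hp : Irreducible p) (h0 : p.coeff 0 ≠ 0) (x : GA k Q rel) :
    x ∈ TwoSidedIdeal.span (annJ k Q rel c ∪ {Polynomial.aeval cm p}) ↔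
      ∀ a b, Polynomial.expand k n p ∣ hf.rho k x a b := by
  refine ⟨fun h => ?_, hf.mem_of_dvd hp h0 (TwoSidedIdeal.subset_span (Or.inr rfl))⟩
  induction h using TwoSidedIdeal.span_induction with
  | mem x hx =>
    rcases hx with hx | rfl
    · simp [(hf.mem_annJ hc).1 hx]
    · intro a b
      rw [rho_aeval, Matrix.algebraMap_matrix_apply]
      split_ifs
      · exact dvd_rfl
      · exact dvd_zero _
  | zero => simp
  | add x y _ _ hx hy =>
    intro a b
    rw [map_add]
    exact dvd_add (hx a b) (hy a b)
  | neg x _ hx =>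
    intro a b
    rw [show hf.rho k (-x) = -hf.rho k x from map_neg _ _]
    exact (dvd_neg.2 (hx a b))
  | left_absorb y x _ hx =>
    intro a b
    rw [map_mul, Matrix.mul_apply]
    exact Finset.dvd_sum fun i _ => (hx i b).mul_left _
  | right_absorb y x _ hx =>
    intro a b
    rw [map_mul, Matrix.mul_apply]
    exact Finset.dvd_sum fun i _ => (hx a i).mul_right _

theorem mem_of_rho_eq_zero {P : TwoSidedIdeal (GA k Q rel)} (hP : IsPrimeTI k Q rel P)
    {i : ZMod n} (hi : arr k Q rel (f i) ∉ P) {x : GA k Q rel} (hx : hf.rho k x = 0) : x ∈ P := by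
  refine (hP.2 x _ fun y => ?_).resolve_right hi
  rw [hf.mul_arr_eq_zero (x := x * y) (by simp [hx])]
  exact P.zero_mem

theorem cycleSum_notMem {P : TwoSidedIdeal (GA k Q rel)} (hP : IsPrimeTI k Q rel P)
    {i : ZMod n} (hi : arr k Q rel (f i) ∉ P) : cm ∉ P := by
  intro h
  apply hi
  refine or_self_iff.1 (hP.2 _ _ fun x => ?_)
  obtain ⟨g, hg⟩ := hf.exists_cyclePath_mul_eq
    (hf.mul_mem_pathSpan x (arr_mem_pathSpan i)) one_pos (i := i) (by simp)
  rw [mul_assoc, ← cyclePath_one]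
  rw [← cyclePath_one] at hg
  rw [hg]
  exact P.mul_mem_left _ _ (P.mul_mem_right _ _ h)

/-- A prime ideal not containing some arrow of a cycle is either the kernel of the associated
representation, or given by divisibility of matrix entries by an irreducible polynomial. -/
theorem mem_iff_of_arr_notMem {P : TwoSidedIdeal (GA k Q rel)} (hP : IsPrimeTI k Q rel P)
    {i : ZMod n} (hi : arr k Q rel (f i) ∉ P) :
    (∀ x, x ∈ P ↔ hf.rho k x = 0) ∨ ∃ p : Polynomial k, Irreducible p ∧ p.coeff 0 ≠ 0 ∧
      ∀ x, x ∈ P ↔ ∀ a b, Polynomial.expand k n p ∣ hf.rho k x a b := by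
  have hn := NeZero.pos n
  by_cases hker : ∀ x ∈ P, hf.rho k x = 0
  · exact Or.inl fun x => ⟨hker x, hf.mem_of_rho_eq_zero hP hi⟩
  right
  let I : Ideal (Polynomial k) :=
    { carrier := {g | Polynomial.aeval cm g ∈ P}
      add_mem' := fun {g g'} hg hg' => by
        simp only [Set.mem_ofPred_eq, map_add] at *
        exact add_mem hg hg'
      zero_mem' := by simp
      smul_mem' := fun g g' hg' => by
        simp only [Set.mem_ofPred_eq, smul_eq_mul, map_mul] at *
        exact P.mul_mem_left _ _ hg' }
  have hI : ∀ g, g ∈ I ↔ Polynomial.aeval cm g ∈ P := fun g => Iff.rfl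
  have hIX : Polynomial.X ∉ I := by
    rw [hI, Polynomial.aeval_X]
    exact hf.cycleSum_notMem hP hi
  have hIprime : I.IsPrime := by
    refine ⟨fun h => hIX (h ▸ Submodule.mem_top), fun {g g'} h => ?_⟩
    rw [hI, map_mul] at h
    refine hP.2 _ _ fun x => ?_
    rw [← (hf.commute_aeval g x).eq, mul_assoc]
    exact P.mul_mem_left _ _ h
  have key : ∀ x ∈ P, ∀ a b, ∀ g : Polynomial k,
      cp a n * (x * cp b ((a - b).val + n)) = cp a n * (cm * Polynomial.aeval cm g) → g ∈ I := by
    intro x hx a b g hg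
    have h1 : cm ^ 3 * (cm * Polynomial.aeval cm g) ∈ P :=
      hf.cycleSum_pow_mul_mem (fun y => (hf.commute_cycleSum y).mul_right (hf.commute_aeval g y))
        (hg ▸ P.mul_mem_left _ _ (P.mul_mem_right _ _ hx))
    have h2 : Polynomial.X ^ 4 * g ∈ I := by
      rw [hI, map_mul, map_pow, Polynomial.aeval_X]
      rwa [← mul_assoc, ← pow_succ] at h1
    exact (hIprime.mem_or_mem h2).resolve_left fun h => hIX (hIprime.mem_of_pow_mem _ h)
  push Not at hker
  obtain ⟨x, hx, hx0⟩ := hker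
  have hI0 : I ≠ ⊥ := by
    intro h
    apply hx0
    ext1 a b
    obtain ⟨g, hg1, hg⟩ := hf.exists_cyclePath_mul_mul_eq x a b
    have h1 := key x hx a b g hg1
    rw [h, Ideal.mem_bot] at h1
    rw [h1, map_zero] at hg
    exact (mul_eq_zero.1 hg).resolve_right (pow_ne_zero _ Polynomial.X_ne_zero)
  set p := Submodule.IsPrincipal.generator I with hp
  have hgen : ∀ g, g ∈ I ↔ p ∣ g := fun g => Submodule.IsPrincipal.mem_iff_generator_dvd I
  have hirr : Irreducible p := (Submodule.IsPrincipal.prime_generator_of_isPrime I hI0).irreducible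
  have h0 : p.coeff 0 ≠ 0 := by
    intro h
    rw [← Polynomial.X_dvd_iff] at h
    exact hIX ((hgen _).2 ((Polynomial.irreducible_X.dvd_symm hirr) h))
  refine ⟨p, hirr, h0, fun y => ⟨fun hy a b => ?_, hf.mem_of_dvd hirr h0 ((hgen p).2 dvd_rfl)⟩⟩
  obtain ⟨g, hg1, hg⟩ := hf.exists_cyclePath_mul_mul_eq y a b
  exact (expand_dvd_iff hirr h0 hg).2 ((hgen g).1 (key y hy a b g hg1))

/-- Modulo the stationary paths, `A` is spanned by the paths along a cycle containing all arrows. -/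
theorem sub_sum_aug_mem (hsurj : ∀ a, ∃ i, f i = a) (x : GA k Q rel) :
    x - ∑ v, aug k rel v x • vtx k Q rel v ∈ ⨆ j, pathSpan k rel f j := by
  let L : GA k Q rel →ₗ[k] GA k Q rel :=
    ∑ v, (aug k rel v).toLinearMap.smulRight (vtx k Q rel v)
  have hL : ∀ y, L y = ∑ v, aug k rel v y • vtx k Q rel v := fun y => by simp [L]
  have hT : ∀ x : GA k Q rel, ∀ y ∈ ⨆ j, pathSpan k rel f j,
      x * y ∈ ⨆ j, pathSpan k rel f j := by
    intro x y hy
    induction hy using Submodule.iSup_induction' with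
    | mem j y hy => exact Submodule.mem_iSup_of_mem j (hf.mul_mem_pathSpan x hy)
    | zero => simp
    | add y z _ _ hy hz => rw [mul_add]; exact add_mem hy hz
  have h1 : x * 1 ∈ (⨆ j, pathSpan k rel f j).comap (LinearMap.id - L) := by
    refine mul_mem_of_generators (fun w y hy => ?_) (fun a y hy => ?_) x 1 ?_
    · simp only [Submodule.mem_comap, LinearMap.sub_apply, LinearMap.id_apply, hL] at hy ⊢
      convert hT (vtx k Q rel w) _ hy using 1
      rw [mul_sub, Finset.mul_sum]
      congr 1
      refine Finset.sum_congr rfl fun v _ => ?_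
      by_cases h : w = v
      · subst h
        simp [vtx_mul_self]
      · simp [h, vtx_mul_vtx_of_ne h]
    · simp only [Submodule.mem_comap, LinearMap.sub_apply, LinearMap.id_apply, hL] at hy ⊢
      have h2 : arr k Q rel a * y - ∑ v, aug k rel v (arr k Q rel a * y) • vtx k Q rel v =
          arr k Q rel a * (y - ∑ v, aug k rel v y • vtx k Q rel v) +
            aug k rel (Q.tgt a) y • arr k Q rel a := by
        simp [mul_sub, Finset.mul_sum, arr_mul_vtx]
      obtain ⟨i, rfl⟩ := hsurj a
      rw [h2]
      exact add_mem (hT _ _ hy) (Submodule.smul_mem _ _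
        (Submodule.mem_iSup_of_mem _ (arr_mem_pathSpan i)))
    · simp [hL, sum_vtx]
  simpa [hL] using h1

/-- The representation is faithful if the cycle contains all arrows. -/
theorem eq_zero_of_rho_eq_zero (hsurj : ∀ a, ∃ i, f i = a) (hv : ∀ v, ∃ a, Q.src a = v)
    {x : GA k Q rel} (hx : hf.rho k x = 0) : x = 0 := by
  have h1 : ∀ v, aug k rel v x = 0 := fun v => by
    obtain ⟨a, rfl⟩ := hv v
    obtain ⟨i, rfl⟩ := hsurj a
    exact aug_eq_zero_of_mul_arr (hf.mul_arr_eq_zero hx i)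
  have h2 := hf.sub_sum_aug_mem hsurj x
  simp only [h1, zero_smul, Finset.sum_const_zero, sub_zero] at h2
  obtain ⟨y, hy, rfl⟩ := (Submodule.mem_iSup_iff_exists_finsupp _ _).1 h2
  refine Finset.sum_eq_zero fun j hj => hf.eq_zero_of_mem_pathSpan (hy j) ?_
  ext1 i j'
  by_cases hj' : j' = j
  · subst hj'
    rw [← hx, Finsupp.sum, map_sum, Matrix.sum_apply]
    symm
    apply Finset.sum_eq_single j'
    · exact fun l _ hl => hf.rho_apply_of_mem_pathSpan (hy l) i hl.symm
    · exact fun h => absurd hj h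
  · exact hf.rho_apply_of_mem_pathSpan (hy j) i hj'

end ArrowCycle

/-- If every arrow of `Q` can be continued, then every vertex is the source of an arrow. -/
theorem exists_src_eq (h : ∀ a : Q.Arr, ∃ b, Q.src b = Q.tgt a) (v : Q.V) : ∃ a, Q.src a = v := by
  obtain ⟨a⟩ := Q.nonemptyA
  by_cases hv : v = Q.src a
  · exact ⟨a, hv.symm⟩
  obtain ⟨w⟩ := Q.connected.preconnected v (Q.src a)
  cases w with
  | nil => exact absurd rfl hv
  | cons hadj _ =>
    rcases hadj.2 with ⟨b, hb, -⟩ | ⟨b, -, hb⟩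
    · exact ⟨b, hb⟩
    · obtain ⟨c, hc⟩ := h b
      exact ⟨c, hc.trans hb⟩

end CyclePrimes

section Words

variable {k : Type} [Field k] {Q : Quiv} {rel : Q.Arr → Q.Arr → Prop}

theorem map_range_mul_eq_flatten {α : Type*} {F : ℕ → α} {e : ℕ} (h : Function.Periodic F e)
    (q : ℕ) : (List.range (q * e)).map F = (List.replicate q ((List.range e).map F)).flatten := by
  induction q with
  | zero => simp
  | succ q ih =>
    rw [Nat.succ_mul, List.range_add, List.map_append, ih, List.replicate_succ',
      List.flatten_append, List.map_map]
    simp only [List.flatten_cons, List.flatten_nil, List.append_nil, List.append_cancel_left_eq]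
    refine List.map_congr_left fun i _ => ?_
    rw [Function.comp_apply, add_comm]
    exact h.nat_mul q i

theorem exists_periodic_dvd {α : Type*} {F : ℕ → α} {n d : ℕ} (hn : Function.Periodic F n)
    (hd : Function.Periodic F d) (hd0 : 0 < d) :
    ∃ e, 0 < e ∧ e ≤ d ∧ e ∣ n ∧ Function.Periodic F e := by
  classical
  have hex : ∃ e, 0 < e ∧ Function.Periodic F e := ⟨d, hd0, hd⟩
  obtain ⟨h1, h2⟩ := Nat.find_spec hex
  refine ⟨Nat.find hex, h1, Nat.find_min' hex ⟨hd0, hd⟩, ?_, h2⟩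
  by_contra h
  have h3 : 0 < n % Nat.find hex := Nat.pos_of_ne_zero fun h0 => h (Nat.dvd_of_mod_eq_zero h0)
  refine Nat.find_min hex (Nat.mod_lt n h1) ⟨h3, fun s => ?_⟩
  rw [← hn s, ← h2.nat_mul (n / Nat.find hex) (s + n % Nat.find hex), add_assoc]
  congr 2
  rw [mul_comm]
  exact Nat.mod_add_div _ _

theorem wordEl_cons (a : Q.Arr) (l : List Q.Arr) :
    wordEl k Q rel (a :: l) = arr k Q rel a * wordEl k Q rel l := by
  simp [wordEl]

theorem wordEl_append (l l' : List Q.Arr) :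
    wordEl k Q rel (l ++ l') = wordEl k Q rel l * wordEl k Q rel l' := by
  simp [wordEl]

theorem wordEl_map_range {n : ℕ} [NeZero n] (f : ZMod n → Q.Arr) (i : ZMod n) (l : ℕ) :
    wordEl k Q rel ((List.range l).map fun j : ℕ => f (i + j)) = cyclePath k rel f i l := by
  induction l with
  | zero => simp [wordEl, cyclePath]
  | succ l ih =>
    rw [List.range_succ, List.map_append, wordEl_append, ih, cyclePath_add, cyclePath_one]
    simp [wordEl]

theorem rotTo_getElem {w : List Q.Arr} (hc : w.Nodup) (t : ℕ) (ht : t < w.length) :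
    rotTo w w[t] = w.drop t ++ w.take t := by
  have h1 : ∀ b ∈ w.take t, (b != w[t]) = true := by
    intro b hb
    obtain ⟨j, hj, rfl⟩ := List.getElem_of_mem hb
    rw [List.getElem_take, bne_iff_ne, Ne, hc.getElem_inj_iff]
    rw [List.length_take] at hj
    omega
  have h2 : w = w.take t ++ w.drop t := (List.take_append_drop t w).symm
  have h3 : w.drop t = w[t] :: w.drop (t + 1) := List.drop_eq_getElem_cons ht
  have h4 : w.dropWhile (fun b => b != w[t]) = w.drop t := by
    conv_lhs => enter [2]; rw [h2]
    rw [List.dropWhile_append_of_pos h1, h3, List.dropWhile_cons_of_neg (by simp)]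
  have h5 : w.takeWhile (fun b => b != w[t]) = w.take t := by
    conv_lhs => enter [2]; rw [h2]
    rw [List.takeWhile_append_of_pos h1, h3, List.takeWhile_cons_of_neg (by simp), List.append_nil]
  rw [rotTo, h4, h5]

/-- A primitive cycle with nonzero square is a cyclic arrangement of distinct arrows. -/
theorem exists_arrowCycle (hg : IsGentleRel Q rel) {w : List Q.Arr} (hc : PrimCycleSq rel w) :
    ∃ (n : ℕ) (_ : NeZero n) (f : ZMod n → Q.Arr), ArrowCycle rel f ∧
      (∀ a, a ∈ w ↔ ∃ i, f i = a) ∧ mEl k Q rel w = cycleSum k rel f := by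
  obtain ⟨hne, hallowed, -, hprim⟩ := hc
  have hn : 0 < w.length := List.length_pos_iff.2 hne
  set n := w.length with hndef
  have hmod : ∀ t, t % n < w.length := fun t => Nat.mod_lt t hn
  let F : ℕ → Q.Arr := fun t => w[t % n]'(hmod t)
  have hFlt : ∀ t (ht : t < w.length), F t = w[t] := fun t ht => by
    simp only [F]
    congr 1
    exact Nat.mod_eq_of_lt ht
  have hFn : Function.Periodic F n := fun t => by simp [F]
  have hcF : w = (List.range n).map F := by
    refine List.ext_getElem (by simp [hndef]) fun i h1 h2 => ?_
    simp [hFlt i h1]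
  have hF : ∀ t, Q.tgt (F t) = Q.src (F (t + 1)) ∧ ¬ rel (F t) (F (t + 1)) := by
    intro t
    have h1 := List.isChain_iff_getElem.1 hallowed (t % n) (by
      have := hmod t
      rw [List.length_append]
      omega)
    have h2 : ∀ i (hi : i < (w ++ w).length), (w ++ w)[i] = F i := by
      intro i hi
      rw [List.length_append] at hi
      rw [List.getElem_append]
      split_ifs with h
      · exact (hFlt i h).symm
      · simp only [F]
        congr 1
        rw [Nat.mod_eq_sub_mod (by omega), Nat.mod_eq_of_lt (by omega)]
    rw [h2, h2] at h1
    have h3 : F (t % n) = F t := by simp [F]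
    have h4 : F (t % n + 1) = F (t + 1) := by simp [F]
    rwa [h3, h4] at h1
  have hstep : ∀ s t, F s = F t → F (s + 1) = F (t + 1) := by
    intro s t h
    by_contra hne
    have h2 := hF t
    rw [← h] at h2
    rcases hg.cond_iii (F s) _ _ hne (hF s).1 h2.1 with h3 | h3
    · exact (hF s).2 h3.1
    · exact h2.2 h3.1
  have hinj : ∀ a b, a < b → b < n → F a ≠ F b := by
    intro a b hab hb h
    have h1 : ∀ t, F (a + t) = F (b + t) := by
      intro t
      induction t with
      | zero => exact h
      | succ t ih => exact hstep _ _ ih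
    have h2 : Function.Periodic F (b - a) := by
      intro s
      have h3 : a ≤ a * n := Nat.le_mul_of_pos_right a hn
      have h4 := h1 (s + a * n - a)
      rw [← hFn.nat_mul a s, ← hFn.nat_mul a (s + (b - a))]
      convert h4.symm using 2 <;> push_cast <;> omega
    obtain ⟨e, he0, hed, ⟨q, hq⟩, he⟩ := exists_periodic_dvd hFn h2 (by omega)
    refine hprim ((List.range e).map F) q ?_ ?_
    · by_contra! hq2
      have : q = 0 ∨ q = 1 := by omega
      rcases this with rfl | rfl <;> omega
    · rw [← map_range_mul_eq_flatten he, mul_comm, ← hq]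
      exact hcF
  have hinj' : ∀ a b, a < n → b < n → F a = F b → a = b := by
    intro a b ha hb h
    rcases lt_trichotomy a b with h1 | h1 | h1
    · exact absurd h (hinj a b h1 hb)
    · exact h1
    · exact absurd h.symm (hinj b a h1 ha)
  have : NeZero n := ⟨hn.ne'⟩
  let f : ZMod n → Q.Arr := fun i => F i.val
  have hfF : ∀ t : ℕ, f t = F t := fun t => by simp [f, F, ZMod.val_natCast]
  have hcast : ∀ i : ZMod n, ∃ t : ℕ, t < n ∧ (t : ZMod n) = i := fun i =>
    ⟨i.val, ZMod.val_lt i, ZMod.natCast_zmod_val i⟩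
  have hnodup : w.Nodup := by
    rw [hcF]
    refine List.Nodup.map_on (fun x hx y hy => ?_) List.nodup_range
    exact hinj' x y (List.mem_range.1 hx) (List.mem_range.1 hy)
  refine ⟨n, this, f, ⟨hg, ?_, ?_, ?_⟩, fun a => ?_, ?_⟩
  · intro i j hij
    exact ZMod.val_injective n (hinj' _ _ (ZMod.val_lt i) (ZMod.val_lt j) hij)
  · intro i
    obtain ⟨t, -, rfl⟩ := hcast i
    rw [← Nat.cast_succ, hfF, hfF]
    exact (hF t).1
  · intro i
    obtain ⟨t, -, rfl⟩ := hcast i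
    rw [← Nat.cast_succ, hfF, hfF]
    exact (hF t).2
  · rw [hcF, List.mem_map]
    constructor
    · rintro ⟨t, -, rfl⟩
      exact ⟨t, hfF t⟩
    · rintro ⟨i, rfl⟩
      exact ⟨i.val, List.mem_range.2 (ZMod.val_lt i), rfl⟩
  · have hrot : ∀ t, t < n → wordEl k Q rel (rotTo w (F t)) = cyclePath k rel f t n := by
      intro t ht
      have h1 : F t = w[t] := hFlt t ht
      have h2 : w.drop t = (List.range (n - t)).map fun j : ℕ => f ((t : ZMod n) + j) := by
        refine List.ext_getElem (by simp [hndef]) fun i h1 h2 => ?_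
        rw [List.length_drop] at h1
        rw [List.getElem_drop, List.getElem_map, List.getElem_range, ← Nat.cast_add, hfF]
        simp only [F]
        congr 1
        rw [Nat.mod_eq_of_lt (by omega)]
      have h3 : w.take t = (List.range t).map fun j : ℕ => f ((0 : ZMod n) + j) := by
        refine List.ext_getElem (by simpa [hndef] using ht.le) fun i h1 h2 => ?_
        rw [List.length_take] at h1
        rw [List.getElem_take, List.getElem_map, List.getElem_range, zero_add, hfF]
        simp only [F]
        congr 1
        rw [Nat.mod_eq_of_lt (by omega)]
      rw [h1, rotTo_getElem hnodup t ht, wordEl_append, h2, h3, wordEl_map_range,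
        wordEl_map_range, cyclePath_mul]
      · congr 1
        omega
      · rw [← Nat.cast_add, Nat.add_sub_cancel' ht.le, ZMod.natCast_self]
    have h1 : mEl k Q rel w = ∑ t ∈ Finset.range n, cyclePath k rel f t n := by
      rw [mEl]
      conv_lhs => enter [1, 2]; rw [hcF]
      rw [List.map_map, ← List.sum_toFinset _ List.nodup_range, List.toFinset_range]
      exact Finset.sum_congr rfl fun t ht => hrot t (Finset.mem_range.1 ht)
    rw [h1, cycleSum]
    refine Finset.sum_bij (fun t _ => (t : ZMod n)) (by simp) ?_ ?_ (by simp)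
    · intro s hs t ht hst
      rw [Finset.mem_range] at hs ht
      have h2 := congrArg ZMod.val hst
      rwa [ZMod.val_natCast, ZMod.val_natCast, Nat.mod_eq_of_lt hs, Nat.mod_eq_of_lt ht] at h2
    · intro i _
      obtain ⟨t, ht, rfl⟩ := hcast i
      exact ⟨t, Finset.mem_range.2 ht, rfl⟩

theorem allowedWord_cons {a b : Q.Arr} {l : List Q.Arr} :
    AllowedWord rel (a :: b :: l) ↔ (Q.tgt a = Q.src b ∧ ¬ rel a b) ∧ AllowedWord rel (b :: l) :=
  List.isChain_cons_cons

theorem exists_allowedWord {a : Q.Arr} {x : GA k Q rel}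
    (hx : arr k Q rel a * (x * arr k Q rel a) ≠ 0) :
    ∃ l, AllowedWord rel (a :: l ++ [a]) := by
  let W : Submodule k (GA k Q rel) :=
    Submodule.span k {y | ∃ l, AllowedWord rel (l ++ [a]) ∧ y = wordEl k Q rel (l ++ [a])}
  have hW : ∀ b, ∀ l, AllowedWord rel (l ++ [a]) →
      arr k Q rel b * wordEl k Q rel (l ++ [a]) ≠ 0 → AllowedWord rel (b :: l ++ [a]) := by
    intro b l hl h
    obtain ⟨d, l', hd⟩ : ∃ d l', l ++ [a] = d :: l' := by
      cases l with
      | nil => exact ⟨a, [], rfl⟩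
      | cons d l => exact ⟨d, l ++ [a], rfl⟩
    rw [List.cons_append]
    rw [hd] at hl h ⊢
    rw [wordEl_cons, ← mul_assoc] at h
    exact allowedWord_cons.2 ⟨allowed_of_arr_mul_arr_ne_zero (left_ne_zero_of_mul h), hl⟩
  have h1 : x * arr k Q rel a ∈ W := by
    refine mul_mem_of_generators (fun v y hy => ?_) (fun b y hy => ?_) x _ ?_
    · induction hy using Submodule.span_induction with
      | mem y hy =>
        obtain ⟨l, hl, rfl⟩ := hy
        have h2 : vtx k Q rel v * wordEl k Q rel (l ++ [a]) = wordEl k Q rel (l ++ [a]) ∨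
            vtx k Q rel v * wordEl k Q rel (l ++ [a]) = 0 := by
          cases l with
          | nil =>
            rw [List.nil_append, wordEl_cons, ← mul_assoc, vtx_mul_arr]
            split_ifs <;> simp
          | cons d l =>
            rw [List.cons_append, wordEl_cons, ← mul_assoc, vtx_mul_arr]
            split_ifs <;> simp
        rcases h2 with h2 | h2
        · rw [h2]
          exact Submodule.subset_span ⟨l, hl, rfl⟩
        · rw [h2]
          exact zero_mem _
      | zero => simp
      | add y z _ _ hy hz => rw [mul_add]; exact add_mem hy hz
      | smul r y _ hy => rw [mul_smul_comm]; exact Submodule.smul_mem _ _ hy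
    · induction hy using Submodule.span_induction with
      | mem y hy =>
        obtain ⟨l, hl, rfl⟩ := hy
        by_cases h0 : arr k Q rel b * wordEl k Q rel (l ++ [a]) = 0
        · rw [h0]
          exact zero_mem _
        · exact Submodule.subset_span ⟨b :: l, hW b l hl h0, by
            rw [List.cons_append, wordEl_cons]⟩
      | zero => simp
      | add y z _ _ hy hz => rw [mul_add]; exact add_mem hy hz
      | smul r y _ hy => rw [mul_smul_comm]; exact Submodule.smul_mem _ _ hy
    · exact Submodule.subset_span ⟨[], List.isChain_singleton _, by simp [wordEl]⟩
  by_contra! hno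
  apply hx
  generalize x * arr k Q rel a = y at h1 ⊢
  induction h1 using Submodule.span_induction with
  | mem y hy =>
    obtain ⟨l, hl, rfl⟩ := hy
    by_contra h0
    exact hno l (hW a l hl h0)
  | zero => simp
  | add y z _ _ hy hz => rw [mul_add, hy, hz, add_zero]
  | smul r y _ hy => rw [mul_smul_comm, hy, smul_zero]

theorem infThrough_of_allowedWord {a : Q.Arr} (h : ∃ l, AllowedWord rel (a :: l ++ [a])) :
    InfThrough rel a := by
  classical
  have hex : ∃ m, ∃ l : List Q.Arr, l.length = m ∧ AllowedWord rel (a :: l ++ [a]) := by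
    obtain ⟨l, hl⟩ := h
    exact ⟨_, l, rfl, hl⟩
  obtain ⟨l, hlen, hl⟩ := Nat.find_spec hex
  have hmin : ∀ l', AllowedWord rel (a :: l' ++ [a]) → l.length ≤ l'.length := fun l' hl' =>
    hlen ▸ Nat.find_min' hex ⟨l', rfl, hl'⟩
  have h1 := List.isChain_append.1 hl
  refine ⟨a :: l, ⟨by simp, ?_, ?_, ?_⟩, by simp⟩
  · exact List.isChain_append.2 ⟨h1.1, h1.1, fun x hx y hy => h1.2.2 x hx y (by simpa using hy)⟩
  · obtain ⟨y, hy⟩ : ∃ y, y ∈ (a :: l).getLast? :=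
      ⟨_, List.getLast?_eq_getLast_of_ne_nil (by simp)⟩
    have h2 := (h1.2.2 y hy a (by simp)).1
    rw [Option.mem_def] at hy
    rw [wTgt?, wSrc?, hy]
    simp [h2]
  · intro w q hq hw
    obtain ⟨q, rfl⟩ : ∃ q', q = q' + 2 := ⟨q - 2, by omega⟩
    cases w with
    | nil => simp at hw
    | cons b w =>
      simp only [List.replicate_succ, List.flatten_cons, List.cons_append, List.cons.injEq] at hw
      obtain ⟨rfl, hw⟩ := hw
      have h3 := hmin w (by
        rw [hw] at hl
        refine List.IsChain.left_of_append
          (l₂ := w ++ (List.replicate q (a :: w)).flatten ++ [a]) ?_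
        change AllowedWord rel _
        simpa using hl)
      rw [hw] at h3
      simp at h3

end Words

section PrimeIdeals

variable {k : Type} [Field k] {Q : Quiv} {rel : Q.Arr → Q.Arr → Prop}

theorem polyEval_eq_aeval (p : Polynomial k) (x : GA k Q rel) :
    polyEval k Q rel p x = Polynomial.aeval x p := rfl

theorem ArrowCycle.coe_eq_annJ_iff {n : ℕ} [NeZero n] {f : ZMod n → Q.Arr}
    (hf : ArrowCycle rel f) {w : List Q.Arr} (hw : ∀ a, a ∈ w ↔ ∃ i, f i = a)
    {P : TwoSidedIdeal (GA k Q rel)} :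
    (P : Set (GA k Q rel)) = annJ k Q rel w ↔ ∀ x, x ∈ P ↔ hf.rho k x = 0 := by
  rw [Set.ext_iff]
  simp only [hf.mem_annJ hw, SetLike.mem_coe]

/-- An arrow outside a prime ideal lies on an infinite maximal path. -/
theorem infThrough_of_arr_notMem {P : TwoSidedIdeal (GA k Q rel)} (hP : IsPrimeTI k Q rel P)
    {a : Q.Arr} (ha : arr k Q rel a ∉ P) : InfThrough rel a := by
  obtain ⟨x, hx⟩ : ∃ x, arr k Q rel a * x * arr k Q rel a ∉ P := by
    by_contra! h
    exact ha (or_self_iff.1 (hP.2 _ _ h))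
  refine infThrough_of_allowedWord (exists_allowedWord (k := k) (x := x) fun h => hx ?_)
  rw [mul_assoc, h]
  exact P.zero_mem

theorem isPrimeTI_of_coe_eq_annJ (hg : IsGentleRel Q rel) {w : List Q.Arr} (hw : PrimCycleSq rel w)
    {P : TwoSidedIdeal (GA k Q rel)} (h : (P : Set (GA k Q rel)) = annJ k Q rel w) :
    IsPrimeTI k Q rel P := by
  obtain ⟨n, _, f, hf, hwf, -⟩ := exists_arrowCycle (k := k) hg hw
  exact hf.isPrimeTI_of_mem_iff ((hf.coe_eq_annJ_iff hwf).1 h)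

theorem exists_coe_eq_annJ (hg : IsGentleRel Q rel) {w : List Q.Arr} (hw : PrimCycleSq rel w) :
    ∃ P : TwoSidedIdeal (GA k Q rel), (P : Set (GA k Q rel)) = annJ k Q rel w := by
  obtain ⟨n, _, f, hf, hwf, -⟩ := exists_arrowCycle (k := k) hg hw
  exact ⟨TwoSidedIdeal.ker (hf.rho k), (hf.coe_eq_annJ_iff hwf).2 fun _ => TwoSidedIdeal.mem_ker _⟩

theorem isPrimeTI_span (hg : IsGentleRel Q rel) {w : List Q.Arr}
    (hw : PrimCycleSq rel w) {p : Polynomial k}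
    (hp : Irreducible p) (h0 : p.coeff 0 ≠ 0) :
    IsPrimeTI k Q rel (TwoSidedIdeal.span
      (annJ k Q rel w ∪ {polyEval k Q rel p (mEl k Q rel w)})) := by
  obtain ⟨n, _, f, hf, hwf, hm⟩ := exists_arrowCycle (k := k) hg hw
  rw [hm, polyEval_eq_aeval]
  exact hf.isPrimeTI_of_mem_iff_dvd hp h0 (hf.mem_span_iff hwf hp h0)

theorem isPrimeTI_iff (hg : IsGentleRel Q rel) (P : TwoSidedIdeal (GA k Q rel)) :
    IsPrimeTI k Q rel P ↔
      (∃ v : Q.V, P = mIdeal k Q rel v) ∨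
      (∃ w : List Q.Arr, PrimCycleSq rel w ∧ (P : Set (GA k Q rel)) = annJ k Q rel w) ∨
      (∃ (w : List Q.Arr) (p : Polynomial k), PrimCycleSq rel w ∧ Irreducible p ∧
        1 ≤ p.natDegree ∧ p.coeff 0 ≠ 0 ∧
        P = TwoSidedIdeal.span (annJ k Q rel w ∪ {polyEval k Q rel p (mEl k Q rel w)})) := by
  constructor
  · intro hP
    by_cases h : ∀ a, arr k Q rel a ∈ P
    · exact Or.inl (exists_eq_mIdeal hP h)
    push Not at h
    obtain ⟨a, ha⟩ := h
    obtain ⟨w, hw, haw⟩ := infThrough_of_arr_notMem hP ha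
    obtain ⟨n, _, f, hf, hwf, hm⟩ := exists_arrowCycle (k := k) hg hw
    obtain ⟨i, rfl⟩ := (hwf a).1 haw
    rcases hf.mem_iff_of_arr_notMem hP ha with h1 | ⟨p, hp, h0, h1⟩
    · exact Or.inr (Or.inl ⟨w, hw, (hf.coe_eq_annJ_iff hwf).2 h1⟩)
    · refine Or.inr (Or.inr ⟨w, p, hw, hp, hp.natDegree_pos, h0, ?_⟩)
      rw [hm, polyEval_eq_aeval]
      ext x
      rw [h1, hf.mem_span_iff hwf hp h0]
  · rintro (⟨v, rfl⟩ | ⟨w, hw, h⟩ | ⟨w, p, hw, hp, -, h0, rfl⟩)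
    · exact isPrimeTI_mIdeal v
    · exact isPrimeTI_of_coe_eq_annJ hg hw h
    · exact isPrimeTI_span hg hw hp h0

theorem eq_of_coe_eq_annJ_of_le (hg : IsGentleRel Q rel) {w : List Q.Arr} (hw : PrimCycleSq rel w)
    {P P' : TwoSidedIdeal (GA k Q rel)} (h : (P : Set (GA k Q rel)) = annJ k Q rel w)
    (hP' : IsPrimeTI k Q rel P') (hle : P' ≤ P) : P' = P := by
  obtain ⟨n, _, f, hf, hwf, -⟩ := exists_arrowCycle (k := k) hg hw
  have h1 := (hf.coe_eq_annJ_iff hwf).1 h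
  refine le_antisymm hle fun x hx => ?_
  refine hf.mem_of_rho_eq_zero hP' (i := 0) (fun h2 => ?_) ((h1 x).1 hx)
  exact arr_ne_zero _ (hf.eq_zero_of_mem_pathSpan (ArrowCycle.arr_mem_pathSpan 0)
    ((h1 _).1 (hle h2)))

theorem eq_mIdeal_of_le_of_not_exists (hg : IsGentleRel Q rel) {v : Q.V}
    (hv : ¬ ∃ (w : List Q.Arr) (a : Q.Arr), PrimCycleSq rel w ∧ a ∈ w ∧ Q.src a = v)
    {P : TwoSidedIdeal (GA k Q rel)} (hP : IsPrimeTI k Q rel P) (hle : P ≤ mIdeal k Q rel v) :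
    P = mIdeal k Q rel v := by
  by_cases h : ∀ a, arr k Q rel a ∈ P
  · obtain ⟨u, rfl⟩ := exists_eq_mIdeal hP h
    exact (eq_mIdeal_of_le (isPrimeTI_mIdeal v).1 hle).symm
  push Not at h
  obtain ⟨a, ha⟩ := h
  obtain ⟨w, hw, haw⟩ := infThrough_of_arr_notMem hP ha
  obtain ⟨n, _, f, hf, hwf, -⟩ := exists_arrowCycle (k := k) hg hw
  obtain ⟨i, rfl⟩ := (hwf a).1 haw
  have h1 : hf.rho k (vtx k Q rel v) = 0 := by
    rw [hf.rho_vtx, Matrix.diagonal_eq_zero]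
    ext1 j
    exact if_neg fun h2 => hv ⟨w, f j, hw, (hwf _).2 ⟨j, rfl⟩, h2⟩
  have h2 := hle (hf.mem_of_rho_eq_zero hP ha h1)
  simp [mem_mIdeal] at h2

theorem isPrimeTI_bot_iff (hg : IsGentleRel Q rel) :
    IsPrimeTI k Q rel (⊥ : TwoSidedIdeal (GA k Q rel)) ↔
    ∃ w : List Q.Arr, PrimCycleSq rel w ∧ ∀ a : Q.Arr, a ∈ w := by
  constructor
  · intro hP
    have h0 : ∀ a, arr k Q rel a ∉ (⊥ : TwoSidedIdeal (GA k Q rel)) := fun a h =>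
      arr_ne_zero a ((TwoSidedIdeal.mem_bot _).1 h)
    obtain ⟨a⟩ := Q.nonemptyA
    obtain ⟨w, hw, haw⟩ := infThrough_of_arr_notMem hP (h0 a)
    obtain ⟨n, _, f, hf, hwf, -⟩ := exists_arrowCycle (k := k) hg hw
    obtain ⟨i, rfl⟩ := (hwf a).1 haw
    refine ⟨w, hw, fun b => ?_⟩
    by_contra hb
    rw [hwf, not_exists] at hb
    exact h0 b (hf.mem_of_rho_eq_zero hP (h0 (f i)) (hf.rho_arr_eq_zero hb))
  · rintro ⟨w, hw, hall⟩
    obtain ⟨n, _, f, hf, hwf, -⟩ := exists_arrowCycle (k := k) hg hw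
    have hsurj : ∀ a, ∃ i, f i = a := fun a => (hwf a).1 (hall a)
    refine hf.isPrimeTI_of_mem_iff fun x => ?_
    rw [TwoSidedIdeal.mem_bot]
    refine ⟨fun h => by rw [h, map_zero], hf.eq_zero_of_rho_eq_zero hsurj (exists_src_eq ?_)⟩
    intro a
    obtain ⟨i, rfl⟩ := hsurj a
    exact ⟨f (i + 1), (hf.comp i).symm⟩

theorem annJ_subset_mIdeal {w : List Q.Arr} {a : Q.Arr} (ha : a ∈ w) :
    annJ k Q rel w ⊆ (mIdeal k Q rel (Q.src a) : Set (GA k Q rel)) := fun _ hx =>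
  mem_mIdeal.2 (aug_eq_zero_of_mul_arr (hx _ (TwoSidedIdeal.subset_span ⟨a, ha, rfl⟩)))

theorem minimal_prime_iff (hg : IsGentleRel Q rel) (P : TwoSidedIdeal (GA k Q rel)) :
    (IsPrimeTI k Q rel P ∧
      ∀ P' : TwoSidedIdeal (GA k Q rel), IsPrimeTI k Q rel P' →
        (P' : Set (GA k Q rel)) ⊆ (P : Set (GA k Q rel)) → P' = P) ↔
    ((∃ w : List Q.Arr, PrimCycleSq rel w ∧ (P : Set (GA k Q rel)) = annJ k Q rel w) ∨
     (∃ v : Q.V, (¬ ∃ (w : List Q.Arr) (a : Q.Arr),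
          PrimCycleSq rel w ∧ a ∈ w ∧ Q.src a = v) ∧
        P = mIdeal k Q rel v)) := by
  constructor
  · rintro ⟨hP, hmin⟩
    have key : ∀ w, PrimCycleSq rel w → annJ k Q rel w ⊆ (P : Set (GA k Q rel)) →
        (P : Set (GA k Q rel)) = annJ k Q rel w := by
      intro w hw hle
      obtain ⟨K, hK⟩ := exists_coe_eq_annJ (k := k) hg hw
      rw [← hmin K (isPrimeTI_of_coe_eq_annJ hg hw hK) (hK ▸ hle), hK]
    rcases (isPrimeTI_iff hg P).1 hP with ⟨v, rfl⟩ | h | ⟨w, p, hw, -, -, -, rfl⟩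
    · by_cases hv : ∃ (w : List Q.Arr) (a : Q.Arr), PrimCycleSq rel w ∧ a ∈ w ∧ Q.src a = v
      · obtain ⟨w, a, hw, ha, rfl⟩ := hv
        exact Or.inl ⟨w, hw, key w hw (annJ_subset_mIdeal ha)⟩
      · exact Or.inr ⟨v, hv, rfl⟩
    · exact Or.inl h
    · exact Or.inl ⟨w, hw, key w hw fun _ hx => TwoSidedIdeal.subset_span (Or.inl hx)⟩
  · rintro (⟨w, hw, h⟩ | ⟨v, hv, rfl⟩)
    · exact ⟨isPrimeTI_of_coe_eq_annJ hg hw h, fun P' hP' hle =>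
        eq_of_coe_eq_annJ_of_le hg hw h hP' hle⟩
    · exact ⟨isPrimeTI_mIdeal v, fun P' hP' hle => eq_mIdeal_of_le_of_not_exists hg hv hP' hle⟩

end PrimeIdeals

/-- **Theorem 3.4 (thm:primeideals).** Let `A = kQ/I` be a (locally) gentle algebra.  The
prime (two-sided) ideals of `A` are exactly: (1) the ideals `𝔪_v` for `v ∈ Q₀`; (2) the
ideals `ann_A(J_γ)` for `γ` an infinite maximal path; (3) the ideals
`𝔭(γ,p) = ann_A(J_γ) + ⟨p(m_γ)⟩` for `γ` an infinite maximal path and `p ∈ k[t]`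
irreducible with `deg p ≥ 1`, `p(0) ≠ 0`.  In particular `A` is prime iff it has exactly
one maximal path and that path is infinite; the height-zero primes are the `ann_A(J_γ)`
together with the `𝔪_v` for vertices `v` through which no infinite maximal path passes;
and if `γ` passes through `v` and `p ≠ t` is irreducible monic then
`ann_A(J_γ) ⊆ 𝔪_v` and `ann_A(J_γ) ⊆ 𝔭(γ,p)`. -/
theorem statement8 (k : Type) [Field k] [CharZero k] (Q : Quiv)
    (rel : Q.Arr → Q.Arr → Prop) (hgentle : IsGentleRel Q rel) :
    -- the classification of the prime ideals
    (∀ P : TwoSidedIdeal (GA k Q rel),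
      IsPrimeTI k Q rel P ↔
        (∃ v : Q.V, P = mIdeal k Q rel v) ∨
        (∃ c : List Q.Arr, PrimCycleSq rel c ∧ (P : Set (GA k Q rel)) = annJ k Q rel c) ∨
        (∃ (c : List Q.Arr) (p : Polynomial k), PrimCycleSq rel c ∧ Irreducible p ∧
          1 ≤ p.natDegree ∧ p.coeff 0 ≠ 0 ∧
          P = TwoSidedIdeal.span
            (annJ k Q rel c ∪ {polyEval k Q rel p (mEl k Q rel c)}))) ∧
    -- `A` is prime iff it has a unique maximal path, which is infinite
    (IsPrimeTI k Q rel (⊥ : TwoSidedIdeal (GA k Q rel)) ↔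
      ∃ c : List Q.Arr, PrimCycleSq rel c ∧ ∀ a : Q.Arr, a ∈ c) ∧
    -- the height-zero (i.e. minimal) primes
    (∀ P : TwoSidedIdeal (GA k Q rel),
      (IsPrimeTI k Q rel P ∧
        ∀ P' : TwoSidedIdeal (GA k Q rel), IsPrimeTI k Q rel P' →
          (P' : Set (GA k Q rel)) ⊆ (P : Set (GA k Q rel)) → P' = P) ↔
      ((∃ c : List Q.Arr, PrimCycleSq rel c ∧ (P : Set (GA k Q rel)) = annJ k Q rel c) ∨
       (∃ v : Q.V, (¬ ∃ (c : List Q.Arr) (a : Q.Arr),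
            PrimCycleSq rel c ∧ a ∈ c ∧ Q.src a = v) ∧
          P = mIdeal k Q rel v))) ∧
    -- the inclusions
    (∀ (c : List Q.Arr) (v : Q.V) (p : Polynomial k), PrimCycleSq rel c →
      (∃ a ∈ c, Q.src a = v) → Irreducible p → p.Monic → p ≠ Polynomial.X →
        annJ k Q rel c ⊆ (mIdeal k Q rel v : Set (GA k Q rel)) ∧
        annJ k Q rel c ⊆
          (TwoSidedIdeal.span (annJ k Q rel c ∪ {polyEval k Q rel p (mEl k Q rel c)}) :
            Set (GA k Q rel))) := by
  refine ⟨isPrimeTI_iff hgentle, isPrimeTI_bot_iff hgentle, minimal_prime_iff hgentle, ?_⟩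
  rintro c v p - ⟨a, ha, rfl⟩ - - -
  exact ⟨annJ_subset_mIdeal ha, fun _ hx => TwoSidedIdeal.subset_span (Or.inl hx)⟩

end LocGentle
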